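/- (Ulam's conjecture on invariance of measure.) Let a = (aᵢ) be any sequence of positive real numbers with ∑ᵢ aᵢ² < ∞. If E₁ and E₂ are Borel subsets of the Hilbert cube I^ω = [0,1]^ℕ and there exists a surjective d_a-isometry f : E₁ → E₂, then π(E₁) = π(E₂). In other words, the standard product probability measure π on I^ω is d_a-invariant. -/

import Mathlib

open Filter

noncomputable section

/-- Fix a sequence `a` of positive reals with `∑ aᵢ² < ∞`.  The space
`M_a` consists of the real sequences `x` with `∑ aᵢ² xᵢ² < ∞`. -/
def Ma (a : ℕ → ℝ) : Set (ℕ → ℝ) := {x | Summable fun i => (a i) ^ 2 * (x i) ^ 2}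

/-- The inner product `⟨x,y⟩_a = ∑ aᵢ² xᵢ yᵢ` on `M_a`. -/
def innerA (a : ℕ → ℝ) (x y : ℕ → ℝ) : ℝ := ∑' i, (a i) ^ 2 * (x i * y i)

/-- The metric `d_a(x,y) = (∑ aᵢ² (xᵢ - yᵢ)²)^{1/2}`. -/
def da (a : ℕ → ℝ) (x y : ℕ → ℝ) : ℝ := Real.sqrt (∑' i, (a i) ^ 2 * (x i - y i) ^ 2)

/-- `eᵢ`: the sequence with `1` in the `i`-th coordinate and `0` elsewhere. -/
def eSeq (i : ℕ) : ℕ → ℝ := Pi.single i 1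

/-- `Λ(E) = {i | ∃ x ∈ E, ∃ α ≠ 0, x + α eᵢ ∈ E}`. -/
def Lam (E : Set (ℕ → ℝ)) : Set ℕ :=
  {i | ∃ x ∈ E, ∃ α : ℝ, α ≠ 0 ∧ x + α • eSeq i ∈ E}

/-- Convergence of the series `∑ᵢ f i` to `s` in `M_a`: the partial sums
converge to `s` with respect to the metric `d_a`. -/
def ConvSeries (a : ℕ → ℝ) (f : ℕ → ℕ → ℝ) (s : ℕ → ℝ) : Prop :=
  Tendsto (fun n => da a (∑ i ∈ Finset.range n, f i) s) atTop (nhds 0)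

/-- The generalized linear span `GS(E,p)`: all points `p + ∑ᵢ αᵢ (xᵢ - p) ∈ M_a`
with `xᵢ ∈ E`, `αᵢ ∈ ℝ`, the series converging in `M_a`. -/
def GS (a : ℕ → ℝ) (E : Set (ℕ → ℝ)) (p : ℕ → ℝ) : Set (ℕ → ℝ) :=
  {u | u ∈ Ma a ∧ ∃ x : ℕ → ℕ → ℝ, ∃ α : ℕ → ℝ,
    (∀ i, x i ∈ E) ∧ ConvSeries a (fun i => α i • (x i - p)) (u - p)}

/-- `E` is a `d_a`-bounded set. -/
def BoundedA (a : ℕ → ℝ) (E : Set (ℕ → ℝ)) : Prop :=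
  ∃ C : ℝ, ∀ x ∈ E, ∀ y ∈ E, da a x y ≤ C

/-- `f` is a `d_a`-isometry on `E`. -/
def IsIsomOn (a : ℕ → ℝ) (f : (ℕ → ℝ) → ℕ → ℝ) (E : Set (ℕ → ℝ)) : Prop :=
  ∀ x ∈ E, ∀ y ∈ E, da a (f x) (f y) = da a x y

/-- Data for a basic cylinder: each factor is a nonempty closed subinterval
`[lo i, hi i] ⊆ [0,1]`, and all but finitely many factors equal `[0,1]`. -/
def IsBCData (lo hi : ℕ → ℝ) : Prop :=
  (∀ i, 0 ≤ lo i) ∧ (∀ i, lo i ≤ hi i) ∧ (∀ i, hi i ≤ 1) ∧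
    {i | ¬(lo i = 0 ∧ hi i = 1)}.Finite

/-- The product set `∏ᵢ [lo i, hi i]`. -/
def cylSet (lo hi : ℕ → ℝ) : Set (ℕ → ℝ) := {x | ∀ i, x i ∈ Set.Icc (lo i) (hi i)}

/-- `J` is a basic cylinder. -/
def IsBasicCylinder (J : Set (ℕ → ℝ)) : Prop :=
  ∃ lo hi : ℕ → ℝ, IsBCData lo hi ∧ J = cylSet lo hi

/-- The elementary volume of a basic cylinder: the product of the lengths of its
edges (a finite product; it is `0` exactly when some factor is a singleton). -/
def bcVol (lo hi : ℕ → ℝ) : ℝ := ∏ᶠ i, (hi i - lo i)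

/-- `K` is a cylinder of volume `v`: there are a basic cylinder of elementary
volume `v` and a surjective `d_a`-isometry from it onto `K`. -/
def IsCylVol (a : ℕ → ℝ) (K : Set (ℕ → ℝ)) (v : ℝ) : Prop :=
  ∃ lo hi : ℕ → ℝ, IsBCData lo hi ∧ v = bcVol lo hi ∧
    ∃ f : (ℕ → ℝ) → ℕ → ℝ, IsIsomOn a f (cylSet lo hi) ∧ f '' cylSet lo hi = K

/-- `K` is a cylinder. -/
def IsCylinder (a : ℕ → ℝ) (K : Set (ℕ → ℝ)) : Prop := ∃ v : ℝ, IsCylVol a K v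

/-- The `d_a`-diameter of a set. -/
def daDiam (a : ℕ → ℝ) (K : Set (ℕ → ℝ)) : ℝ := sSup (Set.image2 (da a) K K)

/-- `μ_δ(E)`: the infimum of `∑ vol(Kᵢ)` over countable coverings of `E` by
cylinders of `d_a`-diameter `< δ` (`∞` if no such covering exists). -/
def preMu (a : ℕ → ℝ) (δ : ℝ) (E : Set (ℕ → ℝ)) : ENNReal :=
  sInf {m : ENNReal | ∃ (K : ℕ → Set (ℕ → ℝ)) (v : ℕ → ℝ),
    (∀ n, IsCylVol a (K n) (v n)) ∧ (∀ n, daDiam a (K n) < δ) ∧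
    (E ⊆ ⋃ n, K n) ∧ m = ∑' n, ENNReal.ofReal (v n)}

/-- The outer measure `μ(E) = lim_{δ→0⁺} μ_δ(E) = sup_{δ>0} μ_δ(E)`. -/
def muA (a : ℕ → ℝ) (E : Set (ℕ → ℝ)) : ENNReal :=
  ⨆ (δ : ℝ) (_ : 0 < δ), preMu a δ E

/-- The Hilbert cube `I^ω = [0,1]^ℕ`, viewed as a subset of `M_a`. -/
def cube : Set (ℕ → ℝ) := {x | ∀ i, x i ∈ Set.Icc (0 : ℝ) 1}

namespace HilbertCube

open MeasureTheory ProbabilityTheory Set Topology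

/-- The Hilbert cube as a product of copies of the unit interval. -/
abbrev Q : Type := ℕ → unitInterval

/-- The product probability measure on the Hilbert cube. -/
def mu : Measure Q := Measure.infinitePi fun _ => volume

instance : IsProbabilityMeasure mu := by unfold mu; infer_instance

/-- The centred coordinate. -/
def V (j : ℕ) (u : Q) : ℝ := (u j : ℝ) - 1 / 2

@[fun_prop]
lemma continuous_V (j : ℕ) : Continuous (V j) := by unfold V; fun_prop

@[fun_prop]
lemma measurable_V (j : ℕ) : Measurable (V j) := (continuous_V j).measurable

lemma abs_V_le (j : ℕ) (u : Q) : |V j u| ≤ 1 / 2 := by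
  have h := (u j).2
  rw [V, abs_le]; constructor <;> linarith [h.1, h.2]

/-- Resampling the coordinates in `S` preserves the measure. -/
lemma measurePreserving_piecewise (S : Set ℕ) [DecidablePred (· ∈ S)] :
    MeasurePreserving (fun p : Q × Q => S.piecewise p.1 p.2) (mu.prod mu) mu := by
  have hm : Measurable (fun p : Q × Q => S.piecewise p.1 p.2) := by
    refine measurable_pi_lambda _ fun i => ?_
    by_cases hi : i ∈ S
    · simp only [Set.piecewise, hi, if_true]; fun_prop
    · simp only [Set.piecewise, hi, if_false]; fun_prop
  refine ⟨hm, ?_⟩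
  unfold mu
  refine Measure.eq_infinitePi _ fun s t ht => ?_
  rw [Measure.map_apply hm (MeasurableSet.pi s.countable_toSet fun i _ => ht i)]
  have : (fun p : Q × Q => S.piecewise p.1 p.2) ⁻¹' Set.pi s t =
      (Set.pi (s.filter (· ∈ S) : Finset ℕ) t) ×ˢ (Set.pi (s.filter (· ∉ S) : Finset ℕ) t) := by
    ext ⟨w, u⟩
    simp only [mem_preimage, Set.mem_pi, mem_prod, Finset.coe_filter, mem_ofPred_eq,
      Finset.mem_coe]
    constructor
    · intro h
      exact ⟨fun i hi => by simpa [hi.2] using h i hi.1, fun i hi => by simpa [hi.2] using h i hi.1⟩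
    · rintro ⟨h1, h2⟩ i hi
      by_cases hS : i ∈ S
      · simpa [hS] using h1 i ⟨hi, hS⟩
      · simpa [hS] using h2 i ⟨hi, hS⟩
  rw [this, Measure.prod_prod, Measure.infinitePi_pi _ fun i _ => ht i,
    Measure.infinitePi_pi _ fun i _ => ht i, Finset.prod_filter_mul_prod_filter_not]

/-- Events depending on complementary sets of coordinates are independent. -/
lemma mu_inter_of_depends (S : Set ℕ) {A B : Set Q} (hA : MeasurableSet A) (hB : MeasurableSet B)
    (hAS : ∀ u v : Q, (∀ i ∈ S, u i = v i) → u ∈ A → v ∈ A)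
    (hBS : ∀ u v : Q, (∀ i ∉ S, u i = v i) → u ∈ B → v ∈ B) :
    mu (A ∩ B) = mu A * mu B := by
  classical
  have h := measurePreserving_piecewise S
  rw [← h.measure_preimage (hA.inter hB).nullMeasurableSet, ← Measure.prod_prod]
  congr 1
  ext ⟨w, u⟩
  have e1 : ∀ i ∈ S, S.piecewise w u i = w i := fun i hi => by simp [hi]
  have e2 : ∀ i ∉ S, S.piecewise w u i = u i := fun i hi => by simp [hi]
  simp only [mem_preimage, mem_inter_iff, mem_prod]
  exact ⟨fun h => ⟨hAS _ _ e1 h.1, hBS _ _ e2 h.2⟩,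
    fun h => ⟨hAS _ _ (fun i hi => (e1 i hi).symm) h.1,
      hBS _ _ (fun i hi => (e2 i hi).symm) h.2⟩⟩

/-- Reflection of all coordinates in `S`. -/
def flip (S : Set ℕ) (u : Q) : Q := by
  classical exact fun i => if i ∈ S then unitInterval.symm (u i) else u i

lemma measurePreserving_flip (S : Set ℕ) : MeasurePreserving (flip S) mu mu := by
  classical
  have hm : Measurable (flip S) := by
    refine measurable_pi_lambda _ fun i => ?_
    by_cases hi : i ∈ S
    · simp only [flip, hi, if_true]; fun_prop
    · simp only [flip, hi, if_false]; fun_prop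
  refine ⟨hm, ?_⟩
  unfold mu
  refine Measure.eq_infinitePi _ fun s t ht => ?_
  rw [Measure.map_apply hm (MeasurableSet.pi s.countable_toSet fun i _ => ht i)]
  have : flip S ⁻¹' Set.pi s t =
      Set.pi s fun i => if i ∈ S then unitInterval.symm ⁻¹' t i else t i := by
    ext u
    simp only [mem_preimage, Set.mem_pi, flip]
    refine forall₂_congr fun i _ => ?_
    split_ifs <;> rfl
  rw [this, Measure.infinitePi_pi]
  · refine Finset.prod_congr rfl fun i _ => ?_
    split_ifs
    · exact unitInterval.measurePreserving_symm.measure_preimage (ht i).nullMeasurableSet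
    · rfl
  · intro i _
    split_ifs
    · exact unitInterval.measurable_symm (ht i)
    · exact ht i

lemma V_flip_of_mem {S : Set ℕ} {i : ℕ} (h : i ∈ S) (u : Q) : V i (flip S u) = -V i u := by
  simp [V, flip, h, unitInterval.symm]; ring

lemma V_flip_of_notMem {S : Set ℕ} {i : ℕ} (h : i ∉ S) (u : Q) : V i (flip S u) = V i u := by
  simp [V, flip, h]

/-- The series `∑ cⱼ (uⱼ - 1/2)`. -/
def X (c : ℕ → ℝ) (u : Q) : ℝ := ∑' j, c j * V j u

lemma abs_mul_V_le (c : ℕ → ℝ) (u : Q) (j : ℕ) : |c j * V j u| ≤ |c j| := by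
  rw [abs_mul]
  nlinarith [abs_nonneg (c j), abs_V_le j u]

lemma summable_mul_V {c : ℕ → ℝ} (hc : Summable c) (u : Q) : Summable fun j => c j * V j u :=
  Summable.of_norm_bounded hc.abs fun j => abs_mul_V_le c u j

lemma continuous_X {c : ℕ → ℝ} (hc : Summable c) : Continuous (X c) :=
  continuous_tsum (fun j => by fun_prop) hc.abs fun j u => abs_mul_V_le c u j

lemma X_flip_univ (c : ℕ → ℝ) (u : Q) : X c (flip univ u) = -X c u := by
  simp only [X, V_flip_of_mem (mem_univ _), mul_neg, tsum_neg]

lemma half_le_of_symm {A : Set Q} {S : Set ℕ} (h : A ∪ flip S ⁻¹' A = univ)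
    (hA : MeasurableSet A) : 1 / 2 ≤ mu.real A := by
  have h1 : mu.real (flip S ⁻¹' A) = mu.real A := by
    simp only [Measure.real]
    rw [(measurePreserving_flip S).measure_preimage hA.nullMeasurableSet]
  have h2 := measureReal_union_le (μ := mu) A (flip S ⁻¹' A)
  rw [h, probReal_univ, h1] at h2
  linarith

lemma half_le_prob_X_nonneg {c : ℕ → ℝ} (hc : Summable c) : 1 / 2 ≤ mu.real {u | 0 ≤ X c u} := by
  refine half_le_of_symm (S := univ) ?_
    (measurableSet_le measurable_const (continuous_X hc).measurable)
  ext u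
  simp only [mem_union, mem_ofPred_eq, mem_preimage, X_flip_univ, mem_univ, iff_true]
  rcases le_total 0 (X c u) with h | h
  · exact Or.inl h
  · right; linarith

/-- Adding an independent symmetric remainder loses at most a factor `2` in an upper tail. -/
lemma half_mul_prob_le {c : ℕ → ℝ} (hc : Summable c) (F : Finset ℕ) (t : ℝ) :
    1 / 2 * mu.real {u | t ≤ ∑ j ∈ F, c j * V j u} ≤ mu.real {u | t ≤ X c u} := by
  set A := {u | t ≤ X c u}
  have hA : MeasurableSet A := measurableSet_le measurable_const (continuous_X hc).measurable
  have h1 : mu.real (flip (F : Set ℕ)ᶜ ⁻¹' A) = mu.real A := by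
    simp only [Measure.real]
    rw [(measurePreserving_flip _).measure_preimage hA.nullMeasurableSet]
  have hsub : {u | t ≤ ∑ j ∈ F, c j * V j u} ⊆ A ∪ flip (F : Set ℕ)ᶜ ⁻¹' A := by
    intro u hu
    have e (v : Q) := (summable_mul_V hc v).sum_add_tsum_compl (s := F)
    have e1 : ∑ j ∈ F, c j * V j (flip (F : Set ℕ)ᶜ u) = ∑ j ∈ F, c j * V j u :=
      Finset.sum_congr rfl fun j hj => by rw [V_flip_of_notMem (by simpa using hj)]
    have e2 : ∑' x : ↥((F : Set ℕ)ᶜ), c x * V x (flip (F : Set ℕ)ᶜ u) =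
        - ∑' x : ↥((F : Set ℕ)ᶜ), c x * V x u := by
      rw [← tsum_neg]; congr 1; ext j; rw [V_flip_of_mem j.2]; ring
    have a1 := e u
    have a2 := e (flip (F : Set ℕ)ᶜ u)
    rw [e1, e2] at a2
    simp only [mem_union, mem_preimage, A, mem_ofPred_eq, X, ← a1, ← a2]
    rcases le_total 0 (∑' x : ↥((F : Set ℕ)ᶜ), c x * V x u) with h | h
    · left; have : t ≤ _ := hu; linarith
    · right; have : t ≤ _ := hu; linarith
  have h2 := (measureReal_mono hsub (μ := mu)).trans (measureReal_union_le A _)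
  rw [h1] at h2
  linarith

lemma integral_V_comp (j : ℕ) {g : ℝ → ℝ} (hg : Continuous g) :
    ∫ u, g (V j u) ∂mu = ∫ x in (0:ℝ)..1, g (x - 1 / 2) := by
  have h1 : MeasurePreserving (fun u : Q => (u j : ℝ)) mu (volume.restrict (Icc 0 1)) :=
    unitInterval.measurePreserving_coe.comp (measurePreserving_eval_infinitePi _ j)
  rw [intervalIntegral.integral_of_le zero_le_one, ← integral_Icc_eq_integral_Ioc,
    ← h1.map_eq, integral_map h1.measurable.aemeasurable
      (by fun_prop : Continuous fun x : ℝ => g (x - 1 / 2)).aestronglyMeasurable]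
  rfl

lemma integral_V_pow (j n : ℕ) : ∫ u, V j u ^ n ∂mu =
    ((1 / 2) ^ (n + 1) - (-(1 / 2)) ^ (n + 1)) / (n + 1) := by
  rw [integral_V_comp j (continuous_pow n)]
  rw [intervalIntegral.integral_comp_sub_right (fun x => x ^ n), integral_pow]; norm_num

lemma integrable_of_continuous {g : Q → ℝ} (hg : Continuous g) : Integrable g mu := by
  obtain ⟨C, hC⟩ := isCompact_univ.exists_bound_of_continuousOn hg.continuousOn
  exact Integrable.of_bound hg.aestronglyMeasurable C (ae_of_all _ fun x => hC x (mem_univ _))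

lemma iIndepFun_V (c : ℕ → ℝ) : iIndepFun (fun j u => c j * V j u) mu :=
  iIndepFun_infinitePi (P := fun _ => (volume : Measure unitInterval))
    (X := fun j (x : unitInterval) => c j * ((x : ℝ) - 1 / 2)) (fun j => by fun_prop)

lemma moments_sum (c : ℕ → ℝ) (F : Finset ℕ) :
    (∫ u, (∑ j ∈ F, c j * V j u) ^ 2 ∂mu = (∑ j ∈ F, c j ^ 2) / 12) ∧
    (∫ u, (∑ j ∈ F, c j * V j u) ^ 4 ∂mu ≤ 3 * ((∑ j ∈ F, c j ^ 2) / 12) ^ 2) := by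
  induction F using Finset.induction_on with
  | empty => simp
  | insert k F hk ih =>
    obtain ⟨ih2, ih4⟩ := ih
    have hind : IndepFun (fun u => ∑ j ∈ F, c j * V j u) (V k) mu := by
      have := (iIndepFun_V (Function.update c k 1)).indepFun_finsetSum_of_notMem
        (fun j => by fun_prop) hk
      convert this using 1
      · ext u; rw [Finset.sum_apply]
        refine Finset.sum_congr rfl fun j hj => ?_
        rw [Function.update_of_ne]; rintro rfl; exact hk hj
      · ext u; simp
    have hprod (n m : ℕ) : ∫ u, (∑ j ∈ F, c j * V j u) ^ n * V k u ^ m ∂mu =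
        (∫ u, (∑ j ∈ F, c j * V j u) ^ n ∂mu) * ∫ u, V k u ^ m ∂mu := by
      have := hind.comp (measurable_id.pow_const n) (measurable_id.pow_const m)
      exact this.integral_fun_mul_eq_mul_integral
        (by fun_prop : Continuous fun u => (∑ j ∈ F, c j * V j u) ^ n).aestronglyMeasurable
        (by fun_prop : Continuous fun u => V k u ^ m).aestronglyMeasurable
    simp only [Finset.sum_insert hk]
    set Y := fun u => ∑ j ∈ F, c j * V j u
    constructor
    · have e : ∀ u, (c k * V k u + Y u) ^ 2 = c k ^ 2 * (Y u ^ 0 * V k u ^ 2) +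
          2 * c k * (Y u ^ 1 * V k u ^ 1) + Y u ^ 2 * V k u ^ 0 := fun u => by ring
      simp only [Y] at *
      simp only [e]
      rw [integral_add, integral_add, integral_const_mul, integral_const_mul, hprod, hprod, hprod,
        ih2]
      rotate_left
      all_goals try exact integrable_of_continuous (by fun_prop)
      simp only [integral_V_pow]
      simp
      ring
    · have e : ∀ u, (c k * V k u + Y u) ^ 4 = c k ^ 4 * (Y u ^ 0 * V k u ^ 4) +
          4 * c k ^ 3 * (Y u ^ 1 * V k u ^ 3) + 6 * c k ^ 2 * (Y u ^ 2 * V k u ^ 2) +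
          4 * c k * (Y u ^ 3 * V k u ^ 1) + Y u ^ 4 * V k u ^ 0 := fun u => by ring
      simp only [Y] at *
      simp only [e]
      rw [integral_add, integral_add, integral_add, integral_add, integral_const_mul,
        integral_const_mul, integral_const_mul, integral_const_mul,
        hprod, hprod, hprod, hprod, hprod, ih2]
      rotate_left
      all_goals try exact integrable_of_continuous (by fun_prop)
      simp only [integral_V_pow]
      norm_num
      nlinarith [ih4, sq_nonneg (c k ^ 2)]

/-- Paley–Zygmund for finite sums of centred coordinates. -/
lemma prob_finset_sum_ge (c : ℕ → ℝ) (F : Finset ℕ) (r : ℝ) (hr : 0 ≤ r)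
    (hrF : 48 * r ^ 2 ≤ ∑ j ∈ F, c j ^ 2) :
    1 / 16 ≤ mu.real {u | r ≤ ∑ j ∈ F, c j * V j u} := by
  obtain ⟨m2, m4⟩ := moments_sum c F
  set s := (∑ j ∈ F, c j ^ 2) / 12 with hs
  set Y := fun u => ∑ j ∈ F, c j * V j u with hY
  have hYc : Continuous Y := by simp only [hY]; fun_prop
  rcases (Finset.sum_nonneg fun j (_ : j ∈ F) => sq_nonneg (c j)).eq_or_lt with h0 | hpos
  · have hr0 : r = 0 := by nlinarith
    have hz : ∀ j ∈ F, c j = 0 := fun j hj => by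
      simpa using (Finset.sum_eq_zero_iff_of_nonneg fun j _ => sq_nonneg (c j)).1 h0.symm j hj
    have : {u | r ≤ Y u} = univ := by
      ext u
      have : Y u = 0 := Finset.sum_eq_zero fun j hj => by rw [hz j hj, zero_mul]
      simp [this, hr0]
    rw [this]; simp; norm_num
  have hspos : 0 < s := by rw [hs]; linarith
  set A := {u | r ≤ Y u} with hA
  have hAm : MeasurableSet A := measurableSet_le measurable_const hYc.measurable
  have hflip : mu.real (flip univ ⁻¹' A) = mu.real A := by
    simp only [Measure.real]
    rw [(measurePreserving_flip _).measure_preimage hAm.nullMeasurableSet]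
  have hB : (1 : ℝ) / 8 ≤ mu.real (A ∪ flip univ ⁻¹' A) := by
    have hBm : MeasurableSet (A ∪ flip univ ⁻¹' A) :=
      hAm.union ((measurePreserving_flip univ).measurable hAm)
    have hpt : ∀ u, -(1 / 8) * (Y u ^ 4 / s ^ 2) + (21 / 32) * (Y u ^ 2 / s) - 5 / 32 ≤
        (A ∪ flip univ ⁻¹' A).indicator 1 u := by
      intro u
      set z := Y u ^ 2 / s with hz
      have hz0 : 0 ≤ z := by positivity
      have e4 : Y u ^ 4 / s ^ 2 = z ^ 2 := by rw [hz]; ring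
      rw [e4]
      by_cases hu : u ∈ A ∪ flip univ ⁻¹' A
      · rw [indicator_of_mem hu]; simp only [Pi.one_apply]
        nlinarith [sq_nonneg (z - 21 / 8)]
      · rw [indicator_of_notMem hu]
        have hYf : Y (flip univ u) = - Y u := by
          simp only [hY, V_flip_of_mem (mem_univ _), mul_neg, Finset.sum_neg_distrib]
        have h1 : Y u < r := by
          by_contra h; exact hu (Or.inl (not_lt.1 h))
        have h2 : -Y u < r := by
          by_contra h; refine hu (Or.inr ?_); simp only [mem_preimage, hA, mem_ofPred_eq, hYf]
          exact not_lt.1 h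
        have hz4 : z ≤ 1 / 4 := by
          rw [hz, div_le_iff₀ hspos]
          have : Y u ^ 2 ≤ r ^ 2 := by nlinarith
          rw [hs]; linarith
        nlinarith
    have i4 : Integrable (fun u => -(1 / 8) * (Y u ^ 4 / s ^ 2)) mu :=
      integrable_of_continuous (by fun_prop)
    have i2 : Integrable (fun u => (21 / 32) * (Y u ^ 2 / s)) mu :=
      integrable_of_continuous (by fun_prop)
    have := integral_mono (μ := mu) ((i4.add i2).sub (integrable_const (5 / 32)))
      ((integrable_const (1 : ℝ)).indicator hBm) hpt
    rw [integral_indicator hBm, setIntegral_const, smul_eq_mul, mul_one] at this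
    refine le_trans ?_ this
    simp only [Pi.add_apply, Pi.sub_apply]
    rw [integral_sub (by exact i4.add i2) (integrable_const _), integral_add i4 i2,
      integral_const_mul, integral_const_mul, integral_div, integral_div, m2]
    simp only [integral_const, probReal_univ, smul_eq_mul]
    have : (∫ u, Y u ^ 4 ∂mu) / s ^ 2 ≤ 3 := by
      rw [div_le_iff₀ (by positivity)]; exact m4
    rw [div_self hspos.ne']
    linarith
  have := measureReal_union_le (μ := mu) A (flip univ ⁻¹' A)
  rw [hflip] at this
  linarith

/-- Paley–Zygmund for infinite sums of centred coordinates. -/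
lemma prob_X_ge {c : ℕ → ℝ} (hc : Summable c) (r : ℝ) (hr : 0 < r)
    (hrs : r ^ 2 ≤ ∑' j, c j ^ 2) : 1 / 32 ≤ mu.real {u | r / 8 ≤ X c u} := by
  have hs : Summable fun j => c j ^ 2 := by
    by_contra h; rw [tsum_eq_zero_of_not_summable h] at hrs; nlinarith
  obtain ⟨F, hF⟩ : ∃ F : Finset ℕ, 3 / 4 * r ^ 2 < ∑ j ∈ F, c j ^ 2 :=
    (hs.hasSum.eventually_const_lt (by nlinarith)).exists
  have h1 := prob_finset_sum_ge c F (r / 8) (by positivity) (by nlinarith)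
  have h2 := half_mul_prob_le hc F (r / 8)
  linarith

lemma prob_V_ge (k : ℕ) {h : ℝ} (h0 : 0 ≤ h) (h1 : h ≤ 1 / 2) :
    mu.real {u | 1 / 2 - h ≤ V k u} = h := by
  have e : {u : Q | 1 / 2 - h ≤ V k u} =
      (fun u : Q => u k) ⁻¹' Ici (⟨1 - h, by constructor <;> linarith⟩ : unitInterval) := by
    ext u
    simp only [V, mem_ofPred_eq, mem_preimage, mem_Ici, ← Subtype.coe_le_coe]
    constructor <;> intro _ <;> linarith
  have hp : MeasurePreserving (fun u : Q => u k) mu volume := measurePreserving_eval_infinitePi _ k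
  rw [e, Measure.real, hp.measure_preimage measurableSet_Ici.nullMeasurableSet,
    unitInterval.volume_Ici]
  simp [h0]

lemma prob_V_le (k : ℕ) {h : ℝ} (h0 : 0 ≤ h) (h1 : h ≤ 1 / 2) :
    mu.real {u | V k u ≤ -(1 / 2 - h)} = h := by
  refine Eq.trans ?_ (prob_V_ge k h0 h1)
  have hm : MeasurableSet {u : Q | 1 / 2 - h ≤ V k u} :=
    measurableSet_le measurable_const (measurable_V k)
  rw [Measure.real, Measure.real,
    ← (measurePreserving_flip univ).measure_preimage hm.nullMeasurableSet]
  congr 2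
  ext u
  simp only [mem_preimage, mem_ofPred_eq, V_flip_of_mem (mem_univ k)]
  constructor <;> intro _ <;> linarith

lemma mu_real_inter_of_depends (S : Set ℕ) {A B : Set Q} (hA : MeasurableSet A)
    (hB : MeasurableSet B)
    (hAS : ∀ u v : Q, (∀ i ∈ S, u i = v i) → u ∈ A → v ∈ A)
    (hBS : ∀ u v : Q, (∀ i ∉ S, u i = v i) → u ∈ B → v ∈ B) :
    mu.real (A ∩ B) = mu.real A * mu.real B := by
  simp only [Measure.real, mu_inter_of_depends S hA hB hAS hBS, ENNReal.toReal_mul]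

/-- The coordinate `k` is near its extreme values. -/
def strip (k : ℕ) (h : ℝ) : Set Q := {u | 1 / 2 - h ≤ |V k u|}

lemma measurableSet_strip (k : ℕ) (h : ℝ) : MeasurableSet (strip k h) :=
  measurableSet_le measurable_const (measurable_V k).abs

lemma prob_strip_le (k : ℕ) {h : ℝ} (h0 : 0 ≤ h) (h1 : h ≤ 1 / 2) :
    mu.real (strip k h) ≤ 2 * h := by
  have hsub : strip k h ⊆ {u | 1 / 2 - h ≤ V k u} ∪ {u | V k u ≤ -(1 / 2 - h)} := by
    intro u hu
    rcases le_abs.1 (show 1 / 2 - h ≤ |V k u| from hu) with h | h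
    · exact Or.inl h
    · right; simp only [mem_ofPred_eq]; linarith
  have := (measureReal_mono hsub (μ := mu)).trans (measureReal_union_le _ _)
  rw [prob_V_ge k h0 h1, prob_V_le k h0 h1] at this
  linarith

lemma prob_strip_inter_le {k l : ℕ} (hkl : k ≠ l) {h h' : ℝ} (h0 : 0 ≤ h) (h1 : h ≤ 1 / 2)
    (h0' : 0 ≤ h') (h1' : h' ≤ 1 / 2) :
    mu.real (strip k h ∩ strip l h') ≤ 4 * (h * h') := by
  rw [mu_real_inter_of_depends {k} (measurableSet_strip _ _) (measurableSet_strip _ _)]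
  · have := mul_le_mul (prob_strip_le k h0 h1) (prob_strip_le l h0' h1') measureReal_nonneg
      (by positivity)
    linarith
  · intro u v huv hu
    simpa [strip, V, huv k rfl] using hu
  · intro u v huv hu
    simpa [strip, V, huv l (by simpa using hkl.symm)] using hu

/-- `u` violates the constraint `|X c u| ≤ 1/2` while its coordinate `k` is near an extreme. -/
def viol (c : ℕ → ℝ) (k : ℕ) (h : ℝ) : Set Q := strip k h ∩ {u | 1 / 2 < |X c u|}

lemma measurableSet_viol {c : ℕ → ℝ} (hc : Summable c) (k : ℕ) (h : ℝ) :
    MeasurableSet (viol c k h) :=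
  (measurableSet_strip _ _).inter
    (measurableSet_lt measurable_const (continuous_X hc).measurable.abs)

lemma summable_update {c : ℕ → ℝ} (hc : Summable c) (k : ℕ) :
    Summable (Function.update c k 0) := hc.update k 0

lemma X_eq_add {c : ℕ → ℝ} (hc : Summable c) (k : ℕ) (u : Q) :
    X c u = c k * V k u + X (Function.update c k 0) u := by
  rw [X, (summable_mul_V hc u).tsum_eq_add_tsum_ite k, X]
  congr 2; ext j
  by_cases h : j = k
  · subst h; simp
  · simp [h]

/-- A row whose leading entry can push `|X|` beyond `1/2` does so with probability
proportional to the width of the strip. -/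
lemma prob_viol_ge {c : ℕ → ℝ} (hc : Summable c) (k : ℕ) {h w p : ℝ} (h0 : 0 ≤ h)
    (h1 : h ≤ 1 / 2) (hw : 1 / 2 < |c k| * (1 / 2 - h) + w)
    (hp : p ≤ mu.real {u | w ≤ X (Function.update c k 0) u}) :
    h * p ≤ mu.real (viol c k h) := by
  set B := {u | w ≤ X (Function.update c k 0) u}
  have hBm : MeasurableSet B :=
    measurableSet_le measurable_const (continuous_X (summable_update hc k)).measurable
  have hB : ∀ u v : Q, (∀ i ∉ ({k} : Set ℕ), u i = v i) → u ∈ B → v ∈ B := by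
    intro u v huv hu
    have : X (Function.update c k 0) u = X (Function.update c k 0) v := by
      unfold X; congr 1; ext j
      by_cases hj : j = k
      · subst hj; simp
      · simp only [V, huv j hj]
    simpa [B, this] using hu
  rcases le_total 0 (c k) with hk | hk
  · rw [abs_of_nonneg hk] at hw
    calc h * p ≤ mu.real ({u | 1 / 2 - h ≤ V k u} ∩ B) := by
          rw [mu_real_inter_of_depends {k} (measurableSet_le measurable_const (measurable_V k)) hBm
            _ hB, prob_V_ge k h0 h1]
          · gcongr
          · intro u v huv hu
            simpa [V, huv k rfl] using hu
      _ ≤ _ := by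
          refine measureReal_mono fun u hu =>
            ⟨le_trans (b := V k u) hu.1 (le_abs_self (V k u)), ?_⟩
          have a1 : 1 / 2 - h ≤ V k u := hu.1
          have a2 : w ≤ _ := hu.2
          refine lt_of_lt_of_le (b := X c u) ?_ (le_abs_self _)
          rw [X_eq_add hc k]
          nlinarith
  · rw [abs_of_nonpos hk] at hw
    calc h * p ≤ mu.real ({u | V k u ≤ -(1 / 2 - h)} ∩ B) := by
          rw [mu_real_inter_of_depends {k} (measurableSet_le (measurable_V k) measurable_const) hBm
            _ hB, prob_V_le k h0 h1]
          · gcongr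
          · intro u v huv hu
            simpa [V, huv k rfl] using hu
      _ ≤ _ := by
          have a1' (u : Q) (hu : u ∈ ({u | V k u ≤ -(1 / 2 - h)} ∩ B)) :
            V k u ≤ -(1 / 2 - h) := hu.1
          refine measureReal_mono fun u hu =>
            ⟨le_trans (b := -V k u) ?_ (neg_le_abs (V k u)), ?_⟩
          · linarith [a1' u hu]
          have a1 := a1' u hu
          have a2 : w ≤ _ := hu.2
          refine lt_of_lt_of_le (b := X c u) ?_ (le_abs_self _)
          rw [X_eq_add hc k]
          nlinarith

lemma prob_viol_of_rest {c : ℕ → ℝ} (hc : Summable c) (k : ℕ) {r : ℝ} (hr : 0 < r) (hr8 : r ≤ 8)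
    (hrs : r ^ 2 ≤ ∑' j, Function.update c k 0 j ^ 2) (hk : 1 - r / 16 ≤ |c k|) :
    r / 16 * (1 / 32) ≤ mu.real (viol c k (r / 16)) := by
  refine prob_viol_ge hc k (by positivity) (by linarith) (w := r / 8) ?_
    (prob_X_ge (summable_update hc k) r hr hrs)
  nlinarith

lemma prob_viol_of_excess {c : ℕ → ℝ} (hc : Summable c) (k : ℕ) {e : ℝ} (he : 0 < e) (he1 : e ≤ 1)
    (hk : 1 + e ≤ |c k|) :
    e / 5 * (1 / 32) ≤ mu.real (viol c k (e / 5)) := by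
  refine prob_viol_ge hc k (by positivity) (by linarith) (w := 0) ?_
    (le_trans (by norm_num) (half_le_prob_X_nonneg (summable_update hc k)))
  nlinarith

/-- Second moment bound: widths of violating strips of rows with distinct leading columns
are summable with a universal bound. -/
lemma sum_width_lt_one {M : ℕ → ℕ → ℝ} (hM : ∀ i, Summable (M i))
    (hG : 1 - 1 / 20000 ≤ mu.real {u | ∀ i, |X (M i) u| ≤ 1 / 2})
    (R : Finset ℕ) (s : ℕ → ℕ) (hs : Set.InjOn s R) (h : ℕ → ℝ)
    (h0 : ∀ i ∈ R, 0 ≤ h i) (h1 : ∀ i ∈ R, h i ≤ 1 / 2)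
    (hp : ∀ i ∈ R, h i * (1 / 32) ≤ mu.real (viol (M i) (s i) (h i))) :
    ∑ i ∈ R, h i < 1 := by
  by_contra! hS
  set S := ∑ i ∈ R, h i
  set E := fun i => viol (M i) (s i) (h i)
  have hEm : ∀ i, MeasurableSet (E i) := fun i => measurableSet_viol (hM i) _ _
  set G := {u : Q | ∀ i, |X (M i) u| ≤ 1 / 2}
  have hGm : MeasurableSet G := by
    have : G = ⋂ i, {u : Q | |X (M i) u| ≤ 1 / 2} := by ext; simp [G]
    rw [this]
    exact MeasurableSet.iInter fun i =>
      measurableSet_le (continuous_X (hM i)).measurable.abs measurable_const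
  set N : Q → ℝ := fun u => ∑ i ∈ R, (E i).indicator 1 u with hN
  set t : ℝ := 1 / (256 * S) with ht
  have htS : t * S = 1 / 256 := by rw [ht]; field_simp
  have ht0 : 0 < t := by positivity
  have ht1 : t ≤ 1 := by
    rw [ht, div_le_one (by positivity)]; linarith
  have iE (i : ℕ) : Integrable ((E i).indicator (1 : Q → ℝ)) mu :=
    (integrable_const (1 : ℝ)).indicator (hEm i)
  have iEE (i j : ℕ) : Integrable ((E i ∩ E j).indicator (1 : Q → ℝ)) mu :=
    (integrable_const (1 : ℝ)).indicator ((hEm i).inter (hEm j))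
  have hNN : ∀ u, N u ^ 2 = ∑ i ∈ R, ∑ j ∈ R, (E i ∩ E j).indicator 1 u := by
    intro u
    rw [hN, sq, Finset.sum_mul_sum]
    refine Finset.sum_congr rfl fun i _ => Finset.sum_congr rfl fun j _ => ?_
    by_cases h1 : u ∈ E i <;> by_cases h2 : u ∈ E j <;> simp [h1, h2]
  have hpt : ∀ u, 2 * t * N u - t ^ 2 * N u ^ 2 ≤ Gᶜ.indicator 1 u := by
    intro u
    by_cases hu : u ∈ G
    · have : N u = 0 := Finset.sum_eq_zero fun i _ => by
        rw [indicator_of_notMem]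
        intro h
        exact absurd (hu i) (not_le.2 h.2)
      simp [this, hu]
    · rw [indicator_of_mem (show u ∈ Gᶜ from hu)]
      simp only [Pi.one_apply]
      nlinarith [sq_nonneg (1 - t * N u)]
  have iN : Integrable N mu := integrable_finsetSum _ fun i _ => iE i
  have iN2 : Integrable (fun u => N u ^ 2) mu := by
    simp only [hNN]
    exact integrable_finsetSum _ fun i _ => integrable_finsetSum _ fun j _ => iEE i j
  have hint := integral_mono (μ := mu) ((iN.const_mul (2 * t)).sub (iN2.const_mul (t ^ 2)))
      ((integrable_const (1 : ℝ)).indicator hGm.compl) hpt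
  rw [integral_indicator hGm.compl, setIntegral_const, smul_eq_mul, mul_one,
    probReal_compl_eq_one_sub hGm] at hint
  simp only [Pi.sub_apply] at hint
  rw [integral_sub (iN.const_mul _) (iN2.const_mul _), integral_const_mul,
    integral_const_mul] at hint
  have e1 : ∫ u, N u ∂mu = ∑ i ∈ R, mu.real (E i) := by
    rw [hN, integral_finsetSum _ fun i _ => iE i]
    exact Finset.sum_congr rfl fun i _ => integral_indicator_one (hEm i)
  have e2 : ∫ u, N u ^ 2 ∂mu = ∑ i ∈ R, ∑ j ∈ R, mu.real (E i ∩ E j) := by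
    simp only [hNN]
    rw [integral_finsetSum _ fun i _ => integrable_finsetSum _ fun j _ => iEE i j]
    refine Finset.sum_congr rfl fun i _ => ?_
    rw [integral_finsetSum _ fun j _ => iEE i j]
    exact Finset.sum_congr rfl fun j _ => integral_indicator_one ((hEm i).inter (hEm j))
  have l1 : S * (1 / 32) ≤ ∫ u, N u ∂mu := by
    rw [e1, Finset.sum_mul]; exact Finset.sum_le_sum hp
  have l2 : ∫ u, N u ^ 2 ∂mu ≤ (∫ u, N u ∂mu) + 4 * S ^ 2 := by
    have : 4 * S ^ 2 = ∑ i ∈ R, ∑ j ∈ R, 4 * (h i * h j) := by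
      rw [sq, Finset.sum_mul_sum, Finset.mul_sum]
      exact Finset.sum_congr rfl fun i _ => by rw [Finset.mul_sum]
    rw [e1, e2, this, ← Finset.sum_add_distrib]
    refine Finset.sum_le_sum fun i hi => ?_
    calc _ ≤ ∑ j ∈ R, ((if i = j then mu.real (E i) else 0) + 4 * (h i * h j)) := by
          refine Finset.sum_le_sum fun j hj => ?_
          split_ifs with hij
          · subst hij
            rw [inter_self]
            nlinarith [h0 i hi]
          · rw [zero_add]
            refine (measureReal_mono ?_).trans (prob_strip_inter_le
              (fun e => hij (hs hi hj e)) (h0 i hi) (h1 i hi) (h0 j hj) (h1 j hj))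
            exact inter_subset_inter inter_subset_left inter_subset_left
      _ = _ := by rw [Finset.sum_add_distrib]; simp [hi]
  have k1 : t * (S * (1 / 32)) ≤ (2 * t - t ^ 2) * ∫ u, N u ∂mu := by
    have : t ≤ 2 * t - t ^ 2 := by nlinarith
    have hN0 : 0 ≤ S * (1 / 32) := by positivity
    nlinarith
  have k2 : t ^ 2 * ∫ u, N u ^ 2 ∂mu ≤ t ^ 2 * ((∫ u, N u ∂mu) + 4 * S ^ 2) := by gcongr
  have k3 : t ^ 2 * S ^ 2 = (1 / 256) ^ 2 := by rw [← htS]; ring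
  have k4 : t * (S * (1 / 32)) = 1 / 256 * (1 / 32) := by rw [← htS]; ring
  nlinarith

lemma exists_subset_sum_mem {f : ℕ → ℝ} {b s : ℝ} (F : Finset ℕ)
    (hb : ∀ j ∈ F, f j ≤ b) (hs : 0 ≤ s) (hsF : s ≤ ∑ j ∈ F, f j) (hb0 : 0 ≤ b) :
    ∃ G ⊆ F, s ≤ ∑ j ∈ G, f j ∧ ∑ j ∈ G, f j ≤ s + b := by
  induction F using Finset.induction_on with
  | empty => exact ⟨∅, by simp, hsF, by simp; linarith⟩
  | insert k F hk ih =>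
    by_cases h : s ≤ ∑ j ∈ F, f j
    · obtain ⟨G, hG, h1, h2⟩ := ih (fun j hj => hb j (Finset.mem_insert_of_mem hj)) h
      exact ⟨G, hG.trans (Finset.subset_insert _ _), h1, h2⟩
    · refine ⟨insert k F, subset_rfl, hsF, ?_⟩
      rw [Finset.sum_insert hk]
      have := hb k (Finset.mem_insert_self _ _)
      linarith

lemma measurableSet_finset_sum_ge (c : ℕ → ℝ) (F : Finset ℕ) (t : ℝ) :
    MeasurableSet {u | t ≤ ∑ j ∈ F, c j * V j u} :=
  measurableSet_le measurable_const
    (by fun_prop : Continuous fun u => ∑ j ∈ F, c j * V j u).measurable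

lemma half_le_prob_finset_sum_nonneg (c : ℕ → ℝ) (F : Finset ℕ) :
    1 / 2 ≤ mu.real {u | 0 ≤ ∑ j ∈ F, c j * V j u} := by
  refine half_le_of_symm (S := univ) ?_ (measurableSet_finset_sum_ge c F 0)
  ext u
  simp only [mem_union, mem_ofPred_eq, mem_preimage, V_flip_of_mem (mem_univ _), mul_neg,
    Finset.sum_neg_distrib, mem_univ, iff_true]
  rcases le_total 0 (∑ j ∈ F, c j * V j u) with h | h
  · exact Or.inl h
  · right; linarith

/-- If no coefficient is close to `1` in absolute value, the finite sum exceeds half its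
variance by a fixed factor with probability bounded below. -/
lemma prob_finset_sum_ge_pow (c : ℕ → ℝ) {η : ℝ} (hη : 0 < η) (hη8 : η ≤ 1 / 8) (n : ℕ) :
    ∀ F : Finset ℕ, (∀ j ∈ F, |c j| ≤ 1 - η) → ∑ j ∈ F, c j ^ 2 ≤ (n + 1) * (η / 8) →
      1 / 2 * (η / 4) ^ n ≤ mu.real {u | 1 / 2 * (1 + η / 2) * (∑ j ∈ F, c j ^ 2 - η / 8) ≤
        ∑ j ∈ F, c j * V j u} := by
  induction n with
  | zero =>
    intro F hF hs
    rw [pow_zero, mul_one]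
    refine (half_le_prob_finset_sum_nonneg c F).trans (measureReal_mono fun u hu => ?_)
    refine le_trans ?_ (show 0 ≤ ∑ j ∈ F, c j * V j u from hu)
    have : ∑ j ∈ F, c j ^ 2 - η / 8 ≤ 0 := by simpa using hs
    nlinarith
  | succ n ih =>
    intro F hF hs
    push_cast at hs
    by_cases hsn : ∑ j ∈ F, c j ^ 2 ≤ (n + 1) * (η / 8)
    · refine le_trans ?_ (ih F hF hsn)
      rw [pow_succ]
      have : (η / 4) ^ n * (η / 4) ≤ (η / 4) ^ n * 1 := by gcongr; linarith
      linarith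
    push Not at hsn
    have hτ : η / 8 ≤ ∑ j ∈ F, c j ^ 2 := by
      have : (1 : ℝ) * (η / 8) ≤ (n + 1) * (η / 8) := by gcongr; simp
      linarith
    obtain ⟨G, hGF, hGτ, hGp⟩ : ∃ G ⊆ F, η / 8 ≤ ∑ j ∈ G, c j ^ 2 ∧
        η / 4 ≤ mu.real {u | 1 / 2 * (1 + η / 2) * ∑ j ∈ G, c j ^ 2 ≤ ∑ j ∈ G, c j * V j u} := by
      by_cases hj : ∃ j ∈ F, η / 8 ≤ c j ^ 2
      · obtain ⟨j, hjF, hj⟩ := hj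
        refine ⟨{j}, by simpa using hjF, by simpa using hj, ?_⟩
        simp only [Finset.sum_singleton]
        have hc := hF j hjF
        have hc0 := abs_nonneg (c j)
        have key : 1 / 2 * (1 + η / 2) * |c j| ≤ 1 / 2 - η / 4 := by nlinarith
        rcases le_total 0 (c j) with h | h
        · rw [abs_of_nonneg h] at *
          refine (prob_V_ge j (h := η / 4) (by linarith) (by linarith)).ge.trans
            (measureReal_mono fun u hu => ?_)
          have : 1 / 2 - η / 4 ≤ V j u := hu
          simp only [mem_ofPred_eq]
          nlinarith
        · rw [abs_of_nonpos h] at *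
          refine (prob_V_le j (h := η / 4) (by linarith) (by linarith)).ge.trans
            (measureReal_mono fun u hu => ?_)
          have : V j u ≤ -(1 / 2 - η / 4) := hu
          simp only [mem_ofPred_eq]
          nlinarith
      · push Not at hj
        obtain ⟨G, hGF, h1, h2⟩ := exists_subset_sum_mem F (fun j hjF => (hj j hjF).le)
          (by positivity) hτ (by positivity)
        refine ⟨G, hGF, h1, le_trans (by linarith) (prob_finset_sum_ge c G
          (1 / 2 * (1 + η / 2) * ∑ j ∈ G, c j ^ 2) (by positivity) ?_)⟩
        set S := ∑ j ∈ G, c j ^ 2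
        have hS : S ≤ 1 / 32 := by linarith
        have hS0 : 0 ≤ S := by linarith
        have : (1 / 2 * (1 + η / 2)) ^ 2 ≤ (17 / 32) ^ 2 := by gcongr; linarith
        have e : 48 * (1 / 2 * (1 + η / 2) * S) ^ 2 = 48 * (1 / 2 * (1 + η / 2)) ^ 2 * S * S := by
          ring
        rw [e]
        have : 48 * (1 / 2 * (1 + η / 2)) ^ 2 * S ≤ 1 := by nlinarith
        nlinarith
    have hsplit := Finset.sum_sdiff hGF (f := fun j => c j ^ 2)
    have hih := ih (F \ G) (fun j hj => hF j (Finset.mem_sdiff.1 hj).1) (by linarith)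
    set A := {u | 1 / 2 * (1 + η / 2) * ∑ j ∈ G, c j ^ 2 ≤ ∑ j ∈ G, c j * V j u}
    set B := {u | 1 / 2 * (1 + η / 2) * (∑ j ∈ F \ G, c j ^ 2 - η / 8) ≤
        ∑ j ∈ F \ G, c j * V j u}
    have hAB : mu.real (A ∩ B) = mu.real A * mu.real B := by
      refine mu_real_inter_of_depends G (measurableSet_finset_sum_ge _ _ _)
        (measurableSet_finset_sum_ge _ _ _) (fun u v huv hu => ?_) fun u v huv hu => ?_
      · have : ∑ j ∈ G, c j * V j u = ∑ j ∈ G, c j * V j v :=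
          Finset.sum_congr rfl fun j hj => by rw [V, V, huv j hj]
        simpa [A, this] using hu
      · have : ∑ j ∈ F \ G, c j * V j u = ∑ j ∈ F \ G, c j * V j v :=
          Finset.sum_congr rfl fun j hj => by
            rw [V, V, huv j (by simpa using (Finset.mem_sdiff.1 hj).2)]
        simpa [B, this] using hu
    calc 1 / 2 * (η / 4) ^ (n + 1) = (η / 4) * (1 / 2 * (η / 4) ^ n) := by ring
      _ ≤ mu.real A * mu.real B := by gcongr
      _ = mu.real (A ∩ B) := hAB.symm
      _ ≤ _ := by
        refine measureReal_mono fun u hu => ?_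
        have h1 : 1 / 2 * (1 + η / 2) * ∑ j ∈ G, c j ^ 2 ≤ ∑ j ∈ G, c j * V j u := hu.1
        have h2 : 1 / 2 * (1 + η / 2) * (∑ j ∈ F \ G, c j ^ 2 - η / 8) ≤
            ∑ j ∈ F \ G, c j * V j u := hu.2
        simp only [mem_ofPred_eq, ← hsplit, ← Finset.sum_sdiff hGF (f := fun j => c j * V j u)]
        linarith

/-- A normalized row without dominant entry pushes `|X|` beyond `1/2` with probability
bounded below. -/
lemma exists_prob_of_spread {η : ℝ} (hη : 0 < η) (hη8 : η ≤ 1 / 8) :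
    ∃ q > 0, ∀ c : ℕ → ℝ, Summable c → (∀ j, |c j| ≤ 1 - η) → 1 - η / 8 ≤ ∑' j, c j ^ 2 →
      q ≤ mu.real {u | 1 / 2 < |X c u|} := by
  obtain ⟨n, hn⟩ := exists_nat_ge (2 / (η / 8))
  refine ⟨1 / 2 * (1 / 2 * (η / 4) ^ n), by positivity, fun c hc hcη hcs => ?_⟩
  have hs : Summable fun j => c j ^ 2 := by
    by_contra h; rw [tsum_eq_zero_of_not_summable h] at hcs; linarith
  obtain ⟨F, hF⟩ : ∃ F : Finset ℕ, 1 - 3 * η / 16 < ∑ j ∈ F, c j ^ 2 :=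
    (hs.hasSum.eventually_const_lt (by linarith)).exists
  obtain ⟨G, -, h1, h2⟩ := exists_subset_sum_mem (f := fun j => c j ^ 2) (b := 1) F
    (fun j _ => by rw [← sq_abs]; exact pow_le_one₀ (abs_nonneg _) (by linarith [hcη j]))
    (by linarith) hF.le zero_le_one
  have h3 := prob_finset_sum_ge_pow c hη hη8 n G (fun j _ => hcη j) (by
    rw [div_le_iff₀ (by positivity)] at hn; nlinarith)
  have h4 := half_mul_prob_le hc G (1 / 2 * (1 + η / 2) * (∑ j ∈ G, c j ^ 2 - η / 8))
  refine le_trans (by linarith) (h4.trans (measureReal_mono fun u hu => ?_))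
  have hu' : 1 / 2 * (1 + η / 2) * (∑ j ∈ G, c j ^ 2 - η / 8) ≤ X c u := hu
  refine lt_of_lt_of_le (b := X c u) (lt_of_lt_of_le ?_ hu') (le_abs_self _)
  nlinarith

lemma prob_le_of_good {M : ℕ → ℕ → ℝ} {ε : ℝ}
    (hM : ∀ i, Summable (M i))
    (hG : 1 - ε ≤ mu.real {u | ∀ i, |X (M i) u| ≤ 1 / 2}) (i : ℕ) {A : Set Q}
    (hA : A ⊆ {u | 1 / 2 < |X (M i) u|}) : mu.real A ≤ ε := by
  have h1 : {u | ∀ i, |X (M i) u| ≤ 1 / 2} ⊆ {u | |X (M i) u| ≤ 1 / 2} := fun u hu => hu i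
  have hm : MeasurableSet {u : Q | |X (M i) u| ≤ 1 / 2} :=
    measurableSet_le (continuous_X (hM i)).measurable.abs measurable_const
  have h2 : {u | 1 / 2 < |X (M i) u|} = {u | |X (M i) u| ≤ 1 / 2}ᶜ := by ext; simp
  rw [h2] at hA
  have h3 := measureReal_mono hA (μ := mu)
  rw [probReal_compl_eq_one_sub hm] at h3
  linarith [measureReal_mono h1 (μ := mu)]

/-- Off-diagonal mass of the row `c` relative to the entry `k`. -/
def rest (c : ℕ → ℝ) (k : ℕ) : ℝ := ∑' j, Function.update c k 0 j ^ 2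

lemma rest_nonneg (c : ℕ → ℝ) (k : ℕ) : 0 ≤ rest c k := tsum_nonneg fun _ => sq_nonneg _

/-- Structure of the rows of an affine map most of whose values satisfy all constraints. -/
lemma exists_row_structure : ∃ ε : ℝ, 0 < ε ∧ ∀ M : ℕ → ℕ → ℝ, (∀ i, Summable (M i)) →
    1 - ε ≤ mu.real {u | ∀ i, |X (M i) u| ≤ 1 / 2} →
    (∀ i, 1 - 1 / 4096 ≤ ∑' j, M i j ^ 2 → ∃ k, 1 - 1 / 512 ≤ |M i k| ∧ |M i k| ≤ 1 + 1 / 512 ∧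
      √(rest (M i) k) ≤ 1 / 32) ∧
    (∀ R : Finset ℕ, ∀ s : ℕ → ℕ, Set.InjOn s R →
      (∀ i ∈ R, √(rest (M i) (s i)) ≤ 1 / 32 ∧ 1 - √(rest (M i) (s i)) / 16 ≤ |M i (s i)|) →
      ∑ i ∈ R, √(rest (M i) (s i)) ≤ 16) ∧
    (∀ R : Finset ℕ, ∀ s : ℕ → ℕ, Set.InjOn s R →
      (∀ i ∈ R, 1 ≤ |M i (s i)| ∧ |M i (s i)| ≤ 2) → ∑ i ∈ R, (|M i (s i)| - 1) ≤ 5) := by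
  obtain ⟨q, hq, hq'⟩ := exists_prob_of_spread (η := 1 / 512) (by norm_num) (by norm_num)
  refine ⟨min (q / 2) (1 / 1000000), by positivity, fun M hM hG => ⟨?_, ?_, ?_⟩⟩
  · intro i hi
    have hε : min (q / 2) (1 / 1000000) ≤ q / 2 := min_le_left _ _
    have hε' : min (q / 2) (1 / 1000000) ≤ 1 / 1000000 := min_le_right _ _
    obtain ⟨k, hk⟩ : ∃ k, 1 - 1 / 512 < |M i k| := by
      by_contra! h
      have h1 := hq' (M i) (hM i) h (by linarith)
      have h2 := prob_le_of_good hM hG i subset_rfl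
      linarith
    refine ⟨k, hk.le, ?_, ?_⟩
    · by_contra! h
      have h1 := prob_viol_of_excess (hM i) k (e := 1 / 512) (by norm_num) (by norm_num) h.le
      have h2 := prob_le_of_good hM hG i (A := viol (M i) k (1 / 512 / 5)) inter_subset_right
      linarith
    · by_contra! h
      have h1 := prob_viol_of_rest (hM i) k (r := 1 / 32) (by norm_num) (by norm_num)
        ((Real.lt_sqrt (by norm_num)).1 h).le (by linarith)
      have h2 := prob_le_of_good hM hG i (A := viol (M i) k (1 / 32 / 16)) inter_subset_right
      linarith
  · intro R s hs hR
    have hG' : 1 - 1 / 20000 ≤ mu.real {u | ∀ i, |X (M i) u| ≤ 1 / 2} :=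
      le_trans (by linarith [min_le_right (q / 2) (1 / 1000000)]) hG
    have := sum_width_lt_one hM hG' R s hs (fun i => √(rest (M i) (s i)) / 16)
      (fun i _ => by positivity) (fun i hi => by linarith [(hR i hi).1]) (fun i hi => ?_)
    · rw [← Finset.sum_div] at this; linarith
    · rcases (Real.sqrt_nonneg (rest (M i) (s i))).eq_or_lt with h0 | h0
      · rw [← h0]; simp
      · exact prob_viol_of_rest (hM i) (s i) h0 (by linarith [(hR i hi).1])
          (Real.sq_sqrt (rest_nonneg _ _)).le (hR i hi).2
  · intro R s hs hR
    have hG' : 1 - 1 / 20000 ≤ mu.real {u | ∀ i, |X (M i) u| ≤ 1 / 2} :=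
      le_trans (by linarith [min_le_right (q / 2) (1 / 1000000)]) hG
    have := sum_width_lt_one hM hG' R s hs (fun i => (|M i (s i)| - 1) / 5)
      (fun i hi => by linarith [(hR i hi).1]) (fun i hi => by linarith [(hR i hi).2])
      (fun i hi => ?_)
    · rw [← Finset.sum_div] at this; linarith
    · rcases (hR i hi).1.eq_or_lt with h0 | h0
      · rw [← h0]; simp
      · exact prob_viol_of_excess (hM i) (s i) (by linarith) (by linarith [(hR i hi).2])
          (by linarith)

/-- A set of positive measure contains two points differing in exactly the `j`-th coordinate. -/
lemma exists_update_mem {K : Set Q} (hK : MeasurableSet K) (h0 : mu K ≠ 0) (j : ℕ) :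
    ∃ x ∈ K, ∃ t, t ≠ x j ∧ Function.update x j t ∈ K := by
  classical
  by_contra! hcon
  refine h0 ?_
  have hp := measurePreserving_piecewise ({j} : Set ℕ)
  rw [← hp.measure_preimage hK.nullMeasurableSet,
    Measure.prod_apply_symm (hp.measurable hK)]
  refine (lintegral_congr fun y => ?_).trans lintegral_zero
  rcases ((fun p : Q => ({j} : Set ℕ).piecewise p y) ⁻¹' K).eq_empty_or_nonempty with h | ⟨v, hv⟩
  · change mu ((fun p : Q => ({j} : Set ℕ).piecewise p y) ⁻¹' K) = 0
    rw [h, measure_empty]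
  · refine measure_mono_null (t := Function.eval j ⁻¹' {v j}) (fun p hp => ?_) ?_
    · by_contra hne
      refine hcon _ hv (p j) (by simpa using hne) ?_
      convert (show ({j} : Set ℕ).piecewise p y ∈ K from hp) using 1
      ext i
      by_cases h : i = j
      · subst h; simp
      · simp [h]
    · have he : MeasurePreserving (Function.eval j) mu volume :=
        measurePreserving_eval_infinitePi _ j
      rw [he.measure_preimage (measurableSet_singleton _).nullMeasurableSet, measure_singleton]

/-- Maps with equal mutual distances have equal inner products of differences. -/
lemma inner_sub_eq_of_norm_sub_eq {H X : Type*} [NormedAddCommGroup H] [InnerProductSpace ℝ H]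
    {φ ψ : X → H} {K : Set X} (h : ∀ x ∈ K, ∀ y ∈ K, ‖ψ x - ψ y‖ = ‖φ x - φ y‖)
    {x y z w : X} (hx : x ∈ K) (hy : y ∈ K) (hz : z ∈ K) (hw : w ∈ K) :
    inner ℝ (ψ x - ψ y) (ψ z - ψ w) = inner ℝ (φ x - φ y) (φ z - φ w) := by
  have key : ∀ χ : X → H, inner ℝ (χ x - χ y) (χ z - χ w) = (‖χ x - χ w‖ ^ 2 + ‖χ y - χ z‖ ^ 2
      - ‖χ x - χ z‖ ^ 2 - ‖χ y - χ w‖ ^ 2) / 2 := by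
    intro χ
    simp only [← real_inner_self_eq_norm_sq, inner_sub_left, inner_sub_right]
    rw [real_inner_comm (χ x) (χ w), real_inner_comm (χ y) (χ z), real_inner_comm (χ x) (χ z),
      real_inner_comm (χ y) (χ w)]
    ring
  rw [key, key, h x hx w hw, h y hy z hz, h x hx z hz, h y hy w hw]

/-- Equality in Bessel's inequality yields the expansion. -/
lemma hasSum_of_bessel_eq {H : Type*} [NormedAddCommGroup H] [InnerProductSpace ℝ H]
    {w : ℕ → H} (hw : Orthonormal ℝ w) {D : H}
    (hD : HasSum (fun j => inner ℝ (w j) D ^ 2) (‖D‖ ^ 2)) :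
    HasSum (fun j => inner ℝ (w j) D • w j) D := by
  have key : ∀ F : Finset ℕ, ‖∑ j ∈ F, inner ℝ (w j) D • w j - D‖ ^ 2 =
      ‖D‖ ^ 2 - ∑ j ∈ F, inner ℝ (w j) D ^ 2 := by
    intro F
    rw [norm_sub_sq_real, ← real_inner_self_eq_norm_sq (∑ j ∈ F, _), hw.inner_sum, sum_inner]
    simp only [inner_smul_left, conj_trivial, ← sq]
    ring
  have h1 : Tendsto (fun F : Finset ℕ => ‖∑ j ∈ F, inner ℝ (w j) D • w j - D‖ ^ 2) atTop (𝓝 0) := by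
    simp only [key]
    rw [← sub_self (‖D‖ ^ 2)]
    exact (tendsto_const_nhds (x := ‖D‖ ^ 2)).sub hD
  refine tendsto_iff_norm_sub_tendsto_zero.2 ?_
  have h2 := (Real.continuous_sqrt.tendsto 0).comp h1
  rw [Real.sqrt_zero] at h2
  exact h2.congr fun F => Real.sqrt_sq (norm_nonneg _)

/-- The weighted embedding of the cube into `ℓ²`. -/
def emb (a : ℕ → ℝ) (ha : Summable fun i => a i ^ 2) (x : Q) : lp (fun _ : ℕ => ℝ) 2 :=
  ⟨fun i => a i * x i, by
    refine memℓp_gen ?_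
    refine Summable.of_nonneg_of_le (fun i => by positivity) (fun i => ?_) ha
    have := (x i).2
    simp only [ENNReal.toReal_ofNat, Real.rpow_ofNat, norm_mul, mul_pow, Real.norm_eq_abs, sq_abs]
    exact mul_le_of_le_one_right (sq_nonneg _) (pow_le_one₀ this.1 this.2)⟩

lemma emb_apply {a : ℕ → ℝ} (ha : Summable fun i => a i ^ 2) (x : Q) (i : ℕ) :
    emb a ha x i = a i * x i := rfl

lemma norm_sq_emb_sub {a : ℕ → ℝ} (ha : Summable fun i => a i ^ 2) (x y : Q) :
    HasSum (fun i => a i ^ 2 * ((x i : ℝ) - y i) ^ 2) (‖emb a ha x - emb a ha y‖ ^ 2) := by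
  rw [← real_inner_self_eq_norm_sq]
  refine HasSum.congr_fun (lp.hasSum_inner (𝕜 := ℝ) (emb a ha x - emb a ha y)
    (emb a ha x - emb a ha y)) fun i => ?_
  change a i ^ 2 * ((x i : ℝ) - y i) ^ 2 =
    inner ℝ (a i * (x i : ℝ) - a i * y i) (a i * (x i : ℝ) - a i * y i)
  rw [real_inner_self_eq_norm_sq, Real.norm_eq_abs, sq_abs]
  ring

/-- An isometry on a set of positive measure is the restriction of an affine map whose normalized
matrix `T` has orthonormal columns and rows of norm at most one. -/
lemma exists_matrix {a : ℕ → ℝ} (ha0 : ∀ i, 0 < a i) (ha : Summable fun i => a i ^ 2) {K : Set Q}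
    (hK : MeasurableSet K) (h0 : mu K ≠ 0) (f : Q → Q)
    (hf : ∀ x ∈ K, ∀ y ∈ K, ∑' i, a i ^ 2 * ((f x i : ℝ) - f y i) ^ 2 =
      ∑' i, a i ^ 2 * ((x i : ℝ) - y i) ^ 2) :
    ∃ T : ℕ → ℕ → ℝ, (∀ j k, HasSum (fun i => T i j * T i k) (if j = k then 1 else 0)) ∧
      (∀ i, Summable (fun j => T i j ^ 2) ∧ ∑' j, T i j ^ 2 ≤ 1) ∧
      ∀ x ∈ K, ∀ y ∈ K, ∀ i,
        HasSum (fun j => T i j * (a j * ((x j : ℝ) - y j))) (a i * ((f x i : ℝ) - f y i)) := by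
  choose x hx t ht hxt using exists_update_mem hK h0
  set φ := emb a ha
  have hn : ∀ x ∈ K, ∀ y ∈ K, ‖φ (f x) - φ (f y)‖ = ‖φ x - φ y‖ := by
    intro x hx y hy
    rw [← sq_eq_sq₀ (norm_nonneg _) (norm_nonneg _), ← (norm_sq_emb_sub ha _ _).tsum_eq,
      ← (norm_sq_emb_sub ha _ _).tsum_eq, hf x hx y hy]
  set d : ℕ → ℝ := fun j => a j * ((t j : ℝ) - x j j)
  have hd : ∀ j, d j ≠ 0 := fun j =>
    mul_ne_zero (ha0 j).ne' (sub_ne_zero.2 fun h => ht j (Subtype.ext h))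
  have hφ : ∀ j, φ (Function.update (x j) j (t j)) - φ (x j) = lp.single 2 j (d j) := by
    intro j
    ext i
    simp only [lp.coeFn_sub, Pi.sub_apply, lp.coeFn_single, φ, emb_apply]
    by_cases h : i = j
    · subst h; simp [d]; ring
    · simp [h]
  set w : ℕ → lp (fun _ : ℕ => ℝ) 2 :=
    fun j => (d j)⁻¹ • (φ (f (Function.update (x j) j (t j))) - φ (f (x j)))
  have hin : ∀ j, ∀ y ∈ K, ∀ z ∈ K,
      inner ℝ (w j) (φ (f y) - φ (f z)) = a j * ((y j : ℝ) - z j) := by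
    intro j y hy z hz
    rw [inner_smul_left,
      inner_sub_eq_of_norm_sub_eq (ψ := fun x => φ (f x)) hn (hxt j) (hx j) hy hz,
      hφ, lp.inner_single_left]
    simp only [lp.coeFn_sub, Pi.sub_apply, φ, emb_apply]
    have := hd j
    simp
    field_simp
  have hw : Orthonormal ℝ w := by
    rw [orthonormal_iff_ite]
    intro j k
    have e : inner ℝ (w j) (w k) = (d k)⁻¹ * inner ℝ (w j)
        (φ (f (Function.update (x k) k (t k))) - φ (f (x k))) := inner_smul_right _ _ _
    rw [e, hin j _ (hxt k) _ (hx k)]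
    have := hd k
    by_cases h : j = k
    · subst h
      simp only [Function.update_self, if_true]
      exact inv_mul_cancel₀ this
    · simp [h]
  have hwi : ∀ i j, inner ℝ (w j) (lp.single 2 i (1 : ℝ)) = w j i := fun i j => by
    rw [lp.inner_single_right]; simp
  have hcoord : ∀ (z : lp (fun _ : ℕ => ℝ) 2) i, inner ℝ (lp.single 2 i (1 : ℝ)) z = z i :=
    fun z i => by rw [lp.inner_single_left]; simp
  refine ⟨fun i j => w j i, fun j k => ?_, fun i => ⟨?_, ?_⟩, fun y hy z hz i => ?_⟩
  · have := lp.hasSum_inner (𝕜 := ℝ) (w j) (w k)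
    rw [orthonormal_iff_ite.1 hw] at this
    simpa [mul_comm] using this
  · simpa [hwi] using hw.inner_products_summable (x := lp.single 2 i (1 : ℝ))
  · have := hw.tsum_inner_products_le (x := lp.single 2 i (1 : ℝ))
    simpa [hwi] using this
  · have h1 := hasSum_of_bessel_eq hw (D := φ (f y) - φ (f z)) (by
      simp only [hin _ y hy z hz, mul_pow]
      rw [hn y hy z hz]
      exact norm_sq_emb_sub ha y z)
    have h2 := h1.mapL (innerSL ℝ (lp.single 2 i (1 : ℝ) : lp (fun _ : ℕ => ℝ) 2))
    simp only [innerSL_apply_apply, hcoord, hin _ y hy z hz] at h2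
    have e : a i * ((f y i : ℝ) - f z i) = (φ (f y) - φ (f z)) i := mul_sub _ _ _
    rw [e]
    refine h2.congr_fun fun j => ?_
    exact mul_comm _ _

/-- Integrating out the `j`-th coordinate. -/
lemma mu_eq_lintegral_update {A : Set Q} (hA : MeasurableSet A) (j : ℕ) :
    mu A = ∫⁻ y, volume {t | Function.update y j t ∈ A} ∂mu := by
  classical
  have hp := measurePreserving_piecewise ({j} : Set ℕ)
  have he : MeasurePreserving (Function.eval j) mu volume := measurePreserving_eval_infinitePi _ j
  rw [← hp.measure_preimage hA.nullMeasurableSet, Measure.prod_apply_symm (hp.measurable hA)]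
  refine lintegral_congr fun y => ?_
  have hm : MeasurableSet {t | Function.update y j t ∈ A} := measurable_update y hA
  rw [← he.measure_preimage hm.nullMeasurableSet]
  congr 1
  ext p
  have : ({j} : Set ℕ).piecewise p y = Function.update y j (p j) := by
    ext i
    by_cases h : i = j
    · subst h; simp
    · simp [h]
  simp only [mem_preimage, this, Function.eval, mem_ofPred_eq]

/-- The affine bijection of `[0,1]` onto its left or right half. -/
def half (b : Bool) (t : unitInterval) : unitInterval :=
  ⟨(t + if b then 1 else 0) / 2, by
    have := t.2.1; have := t.2.2
    cases b <;> simp <;> constructor <;> linarith⟩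

lemma coe_half (b : Bool) (t : unitInterval) : (half b t : ℝ) = (t + if b then 1 else 0) / 2 := rfl

lemma continuous_half (b : Bool) : Continuous (half b) :=
  Continuous.subtype_mk (by fun_prop) _

lemma volume_preimage_half {B : Set unitInterval} :
    volume (half false ⁻¹' B) + volume (half true ⁻¹' B) = 2 * volume B := by
  have h0 : volume (half false ⁻¹' B) = 2 * volume (((↑) '' B : Set ℝ) ∩ Iic (1 / 2)) := by
    have := Real.volume_preimage_mul_left (a := 1 / 2) (by norm_num)
      (((↑) '' B : Set ℝ) ∩ Iic (1 / 2))
    rw [unitInterval.volume_apply]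
    convert this using 2
    · ext x
      constructor
      · rintro ⟨t, ht, rfl⟩
        refine ⟨⟨_, ht, ?_⟩, ?_⟩
        · rw [coe_half]; simp; ring
        · have := t.2.2; simp; linarith
      · rintro ⟨⟨s, hs, h⟩, h2⟩
        have h3 : 1 / 2 * x ≤ 1 / 2 := h2
        have h : (s : ℝ) = 1 / 2 * x := h
        have h4 := s.2.1
        have hx : x ∈ unitInterval := mem_Icc.2 ⟨by linarith, by linarith⟩
        refine ⟨⟨x, hx⟩, ?_, rfl⟩
        have : half false ⟨x, hx⟩ = s := by
          refine Subtype.ext ?_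
          rw [coe_half]; simp only [h]; simp; ring
        simpa [this] using hs
    · norm_num
  have h1 : volume (half true ⁻¹' B) = 2 * volume (((↑) '' B : Set ℝ) ∩ Ici (1 / 2)) := by
    have h := Real.volume_preimage_mul_left (a := 1 / 2) (by norm_num)
      ((fun x => x + 1 / 2) ⁻¹' (((↑) '' B : Set ℝ) ∩ Ici (1 / 2)))
    rw [measure_preimage_add_right] at h
    rw [unitInterval.volume_apply]
    convert h using 2
    · ext x
      constructor
      · rintro ⟨t, ht, rfl⟩
        refine ⟨⟨_, ht, ?_⟩, ?_⟩
        · rw [coe_half]; simp; ring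
        · have := t.2.1; simp; linarith
      · rintro ⟨⟨s, hs, h⟩, h2⟩
        have h3 : 1 / 2 ≤ 1 / 2 * x + 1 / 2 := h2
        have h : (s : ℝ) = 1 / 2 * x + 1 / 2 := h
        have h4 := s.2.2
        have hx : x ∈ unitInterval := mem_Icc.2 ⟨by linarith, by linarith⟩
        refine ⟨⟨x, hx⟩, ?_, rfl⟩
        have : half true ⟨x, hx⟩ = s := by
          refine Subtype.ext ?_
          rw [coe_half]; simp only [h]; simp; ring
        simpa [this] using hs
    · norm_num
  have h2 : volume (((↑) '' B : Set ℝ) ∩ Ici (1 / 2)) =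
      volume (((↑) '' B : Set ℝ) \ Iic (1 / 2)) := by
    rw [sdiff_eq, compl_Iic]
    exact measure_congr ((ae_eq_refl _).inter Ioi_ae_eq_Ici.symm)
  rw [h0, h1, h2, ← mul_add, measure_inter_add_sdiff _ measurableSet_Iic,
    ← unitInterval.volume_apply]

/-- Halving the `j`-th coordinate. -/
def halfAt (j : ℕ) (b : Bool) (u : Q) : Q := Function.update u j (half b (u j))

lemma measurable_halfAt (j : ℕ) (b : Bool) : Measurable (halfAt j b) := by
  refine Continuous.measurable ?_
  exact continuous_id.update j ((continuous_half b).comp (continuous_apply j))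

lemma mu_preimage_halfAt {A : Set Q} (hA : MeasurableSet A) (j : ℕ) :
    mu (halfAt j false ⁻¹' A) + mu (halfAt j true ⁻¹' A) = 2 * mu A := by
  have e : ∀ b, mu (halfAt j b ⁻¹' A) =
      ∫⁻ y, volume (half b ⁻¹' {t | Function.update y j t ∈ A}) ∂mu := by
    intro b
    rw [mu_eq_lintegral_update (measurable_halfAt j b hA) j]
    simp [halfAt]
  have hm : ∀ b, Measurable fun y => volume (half b ⁻¹' {t | Function.update y j t ∈ A}) := by
    intro b
    have : MeasurableSet {p : Q × unitInterval | Function.update p.1 j (half b p.2) ∈ A} := by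
      refine (Continuous.measurable ?_) hA
      exact continuous_fst.update j ((continuous_half b).comp continuous_snd)
    exact measurable_measure_prodMk_left this
  rw [e, e, ← lintegral_add_left (hm _), mu_eq_lintegral_update hA j, ← lintegral_const_mul']
  · exact lintegral_congr fun y => volume_preimage_half
  · simp

/-- `h` is the affine bijection of the cube onto the box with lower corner `lo` and edges `ℓ`. -/
def IsBoxMap (h : Q → Q) (lo ℓ : ℕ → ℝ) : Prop := ∀ u j, (h u j : ℝ) = lo j + ℓ j * u j

lemma exists_halved {K U : Set Q} (hK : MeasurableSet K) (hU : MeasurableSet U) {r : ℝ}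
    {h : Q → Q} (hh : Measurable h) {lo ℓ : ℕ → ℝ} (hb : IsBoxMap h lo ℓ)
    (hd : r * mu.real (h ⁻¹' U) < mu.real (h ⁻¹' K)) (j : ℕ) :
    ∃ h' lo', Measurable h' ∧ IsBoxMap h' lo' (Function.update ℓ j (ℓ j / 2)) ∧
      r * mu.real (h' ⁻¹' U) < mu.real (h' ⁻¹' K) := by
  have key : ∀ {A : Set Q}, MeasurableSet A → mu.real ((h ∘ halfAt j false) ⁻¹' A) +
      mu.real ((h ∘ halfAt j true) ⁻¹' A) = 2 * mu.real (h ⁻¹' A) := by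
    intro A hA
    have := congrArg ENNReal.toReal (mu_preimage_halfAt (hh hA) j)
    rw [ENNReal.toReal_add (measure_ne_top _ _) (measure_ne_top _ _), ENNReal.toReal_mul] at this
    simpa [Measure.real, preimage_comp] using this
  have hex : ∃ b, r * mu.real ((h ∘ halfAt j b) ⁻¹' U) < mu.real ((h ∘ halfAt j b) ⁻¹' K) := by
    by_contra! hc
    have h0 := hc false; have h1 := hc true
    have e1 := key hK; have e2 := congrArg (r * ·) (key hU)
    linarith
  obtain ⟨b, hbd⟩ := hex
  refine ⟨_, Function.update lo j (lo j + ℓ j * if b then 1 / 2 else 0),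
    hh.comp (measurable_halfAt j b), fun u i => ?_, hbd⟩
  rw [Function.comp, hb]
  by_cases hij : i = j
  · subst hij
    cases b <;> simp [halfAt, coe_half] <;> ring
  · simp [halfAt, hij]

lemma exists_halved_range {K U : Set Q} (hK : MeasurableSet K) (hU : MeasurableSet U) {r : ℝ}
    {h : Q → Q} (hh : Measurable h) {lo ℓ : ℕ → ℝ} (hb : IsBoxMap h lo ℓ)
    (hd : r * mu.real (h ⁻¹' U) < mu.real (h ⁻¹' K)) (n : ℕ) :
    ∃ h' lo', Measurable h' ∧ IsBoxMap h' lo' (fun j => if j < n then ℓ j / 2 else ℓ j) ∧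
      r * mu.real (h' ⁻¹' U) < mu.real (h' ⁻¹' K) := by
  induction n with
  | zero => exact ⟨h, lo, hh, by simpa using hb, hd⟩
  | succ n ih =>
    obtain ⟨h', lo', hh', hb', hd'⟩ := ih
    obtain ⟨h2, lo2, hh2, hb2, hd2⟩ := exists_halved hK hU hh' hb' hd' n
    refine ⟨h2, lo2, hh2, ?_, hd2⟩
    convert hb2 using 1
    ext j
    rcases lt_trichotomy j n with hj | hj | hj
    · simp [hj, hj.ne, hj.trans n.lt_succ_self]
    · simp [hj]
    · simp [hj.ne', not_lt.2 hj.le, not_lt.2 (Nat.succ_le_of_lt hj)]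

lemma exists_fine_box {K U : Set Q} (hK : MeasurableSet K) (hU : MeasurableSet U) {r : ℝ}
    (hd : r * mu.real U < mu.real K) (n m : ℕ) :
    ∃ h lo, Measurable h ∧ IsBoxMap h lo (fun j => if j < n then (1 / 2) ^ m else 1) ∧
      r * mu.real (h ⁻¹' U) < mu.real (h ⁻¹' K) := by
  induction m with
  | zero => exact ⟨id, 0, measurable_id, fun u j => by simp, by simpa using hd⟩
  | succ m ih =>
    obtain ⟨h', lo', hh', hb', hd'⟩ := ih
    obtain ⟨h2, lo2, hh2, hb2, hd2⟩ := exists_halved_range hK hU hh' hb' hd' n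
    refine ⟨h2, lo2, hh2, ?_, hd2⟩
    convert hb2 using 1
    ext j
    split_ifs <;> ring

/-- A compact set of positive measure nearly fills some box. -/
lemma exists_dense_box {K : Set Q} (hK : IsCompact K) (h0 : mu K ≠ 0) {ε : ℝ} (hε : 0 < ε)
    (hε1 : ε < 1) :
    ∃ h lo ℓ, Measurable h ∧ IsBoxMap h lo ℓ ∧ (∀ j, 0 < ℓ j ∧ ℓ j ≤ 1) ∧
      (∃ ℓ₀ > 0, ∀ j, ℓ₀ ≤ ℓ j) ∧ (∃ n, ∀ j ≥ n, ℓ j = 1) ∧ 1 - ε ≤ mu.real (h ⁻¹' K) := by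
  have hKm := hK.measurableSet
  have hKpos : 0 < mu.real K := ENNReal.toReal_pos h0 (measure_ne_top _ _)
  obtain ⟨U, hKU, hU, hUlt⟩ : ∃ U ⊇ K, IsOpen U ∧ mu U < ENNReal.ofReal (mu.real K / (1 - ε)) := by
    refine K.exists_isOpen_lt_of_lt _ ?_
    rw [ENNReal.lt_ofReal_iff_toReal_lt (measure_ne_top _ _), lt_div_iff₀ (by linarith)]
    change mu.real K * _ < mu.real K
    nlinarith
  have hd : (1 - ε) * mu.real U < mu.real K := by
    rw [ENNReal.lt_ofReal_iff_toReal_lt (measure_ne_top _ _), lt_div_iff₀ (by linarith)] at hUlt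
    rw [mul_comm]; exact hUlt
  choose h lo hh hb hd' using fun n => exists_fine_box hKm hU.measurableSet hd n n
  have hsub : ∃ n, ∀ u, h n u ∈ U := by
    by_contra! hc
    choose y hy using hc
    have hne : ∀ n, (h n ⁻¹' K).Nonempty := fun n => by
      rw [nonempty_iff_ne_empty]
      intro he
      have := hd' n
      rw [he, measureReal_empty] at this
      have : 0 ≤ (1 - ε) * mu.real (h n ⁻¹' U) := mul_nonneg (by linarith) measureReal_nonneg
      linarith
    choose x hx using hne
    obtain ⟨z, hz, φ, hφ, hlim⟩ := hK.tendsto_subseq hx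
    have hlim2 : Tendsto (fun k => h (φ k) (y (φ k))) atTop (𝓝 z) := by
      rw [tendsto_pi_nhds] at hlim ⊢
      intro j
      have h1 := ((continuous_subtype_val.tendsto _).comp (hlim j))
      rw [tendsto_subtype_rng]
      have h2 : Tendsto (fun k => (1 / 2 : ℝ) ^ (φ k)) atTop (𝓝 0) :=
        (tendsto_pow_atTop_nhds_zero_of_lt_one (by norm_num) (by norm_num)).comp hφ.tendsto_atTop
      have h3 : Tendsto (fun k => (h (φ k) (y (φ k)) j : ℝ) - h (φ k) (x (φ k)) j) atTop (𝓝 0) := by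
        refine squeeze_zero_norm' ?_ h2
        filter_upwards [eventually_gt_atTop j] with k hk
        have hk' : j < φ k := hk.trans_le (hφ.le_apply)
        rw [hb, hb, Real.norm_eq_abs]
        simp only [hk', if_true]
        have e : lo (φ k) j + (1 / 2) ^ φ k * (y (φ k) j : ℝ) -
          (lo (φ k) j + (1 / 2) ^ φ k * (x (φ k) j : ℝ)) =
            (1 / 2) ^ φ k * ((y (φ k) j : ℝ) - x (φ k) j) := by ring
        rw [e, abs_mul, abs_of_pos (by positivity)]
        refine mul_le_of_le_one_right (by positivity) ?_
        rw [abs_le]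
        have := (y (φ k) j).2; have := (x (φ k) j).2
        constructor <;>
          linarith [(y (φ k) j).2.1, (y (φ k) j).2.2, (x (φ k) j).2.1, (x (φ k) j).2.2]
      have := h3.add h1
      simpa using this
    exact (hU.isClosed_compl.mem_of_tendsto hlim2 (Eventually.of_forall fun k => hy _)) (hKU hz)
  obtain ⟨n, hn⟩ := hsub
  refine ⟨h n, lo n, _, hh n, hb n, fun j => ?_, ⟨(1 / 2) ^ n, by positivity, fun j => ?_⟩,
    ⟨n, fun j hj => if_neg (not_lt.2 hj)⟩, ?_⟩
  · split_ifs
    · exact ⟨by positivity, pow_le_one₀ (by norm_num) (by norm_num)⟩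
    · norm_num
  · split_ifs
    · exact le_rfl
    · exact pow_le_one₀ (by norm_num) (by norm_num)
  · have := hd' n
    rw [eq_univ_of_forall (s := h n ⁻¹' U) hn, probReal_univ] at this
    linarith

lemma summable_mul_of_sq {b c : ℕ → ℝ} (hb : Summable fun j => b j ^ 2)
    (hc : Summable fun j => c j ^ 2) : Summable fun j => b j * c j := by
  refine Summable.of_norm_bounded (hb.add hc) fun j => ?_
  rw [Real.norm_eq_abs, abs_le]
  constructor <;> nlinarith [sq_nonneg (b j + c j), sq_nonneg (b j - c j)]

/-- The conclusions of `exists_row_structure`. -/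
structure RowStructure (M : ℕ → ℕ → ℝ) : Prop where
  exists_dominant : ∀ i, 1 - 1 / 4096 ≤ ∑' j, M i j ^ 2 →
    ∃ k, 1 - 1 / 512 ≤ |M i k| ∧ |M i k| ≤ 1 + 1 / 512 ∧ √(rest (M i) k) ≤ 1 / 32
  sum_rest_le : ∀ (R : Finset ℕ) (s : ℕ → ℕ), InjOn s R →
    (∀ i ∈ R, √(rest (M i) (s i)) ≤ 1 / 32 ∧ 1 - √(rest (M i) (s i)) / 16 ≤ |M i (s i)|) →
    ∑ i ∈ R, √(rest (M i) (s i)) ≤ 16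
  sum_excess_le : ∀ (R : Finset ℕ) (s : ℕ → ℕ), InjOn s R →
    (∀ i ∈ R, 1 ≤ |M i (s i)| ∧ |M i (s i)| ≤ 2) → ∑ i ∈ R, (|M i (s i)| - 1) ≤ 5

/-- On a set of positive measure an isometry is affine, and after restriction to a suitable box
its matrix has the row structure. -/
lemma exists_structured_matrix {a : ℕ → ℝ} (ha0 : ∀ i, 0 < a i) (ha : Summable fun i => a i ^ 2)
    {K : Set Q} (hK : IsCompact K) (h0 : mu K ≠ 0) (f : Q → Q)
    (hf : ∀ x ∈ K, ∀ y ∈ K, ∑' i, a i ^ 2 * ((f x i : ℝ) - f y i) ^ 2 =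
      ∑' i, a i ^ 2 * ((x i : ℝ) - y i) ^ 2) :
    ∃ T : ℕ → ℕ → ℝ, (∀ j k, HasSum (fun i => T i j * T i k) (if j = k then 1 else 0)) ∧
      (∀ i, Summable (fun j => T i j ^ 2) ∧ ∑' j, T i j ^ 2 ≤ 1) ∧
      (∀ x ∈ K, ∀ y ∈ K, ∀ i,
        HasSum (fun j => T i j * (a j * ((x j : ℝ) - y j))) (a i * ((f x i : ℝ) - f y i))) ∧
      ∃ ℓ : ℕ → ℝ, (∀ j, 0 < ℓ j ∧ ℓ j ≤ 1) ∧ (∃ ℓ₀ > 0, ∀ j, ℓ₀ ≤ ℓ j) ∧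
        (∃ n, ∀ j ≥ n, ℓ j = 1) ∧ RowStructure fun i j => T i j * (a j * ℓ j) / a i := by
  obtain ⟨T, hT1, hT2, hT3⟩ := exists_matrix ha0 ha hK.measurableSet h0 f hf
  refine ⟨T, hT1, hT2, hT3, ?_⟩
  obtain ⟨ε, hε, hrow⟩ := exists_row_structure
  obtain ⟨h, lo, ℓ, hh, hb, hℓ, hℓ0, hn, hd⟩ := exists_dense_box hK h0
    (ε := min (ε / 2) (1 / 2)) (by positivity) (by linarith [min_le_right (ε / 2) (1 / 2)])
  refine ⟨ℓ, hℓ, hℓ0, hn, ?_⟩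
  have hs : ∀ i, Summable fun j => T i j * (a j * ℓ j) / a i := fun i => by
    refine (summable_mul_of_sq (hT2 i).1 (ha.of_nonneg_of_le (fun j => sq_nonneg _)
      fun j => ?_)).div_const _
    rw [mul_pow]
    exact mul_le_of_le_one_right (sq_nonneg _) (pow_le_one₀ (hℓ j).1.le (hℓ j).2)
  have hgood : 1 - ε ≤ mu.real {u | ∀ i, |X (fun j => T i j * (a j * ℓ j) / a i) u| ≤ 1 / 2} := by
    have hm := hh hK.measurableSet
    have hflip := measurePreserving_flip univ
    have h1 : mu.real (flip univ ⁻¹' (h ⁻¹' K)) = mu.real (h ⁻¹' K) := by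
      rw [measureReal_def, hflip.measure_preimage hm.nullMeasurableSet, measureReal_def]
    have h2 : mu.real (h ⁻¹' K) + mu.real (flip univ ⁻¹' (h ⁻¹' K)) - 1 ≤
        mu.real (h ⁻¹' K ∩ flip univ ⁻¹' (h ⁻¹' K)) := by
      have e1 := measureReal_union_add_inter (μ := mu) (s := h ⁻¹' K)
        (t := flip univ ⁻¹' (h ⁻¹' K)) (hflip.measurable hm)
      have e2 := measureReal_le_one (μ := mu) (s := h ⁻¹' K ∪ flip univ ⁻¹' (h ⁻¹' K))
      linarith
    have h3 : mu.real (h ⁻¹' K ∩ flip univ ⁻¹' (h ⁻¹' K)) ≤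
        mu.real {u | ∀ i, |X (fun j => T i j * (a j * ℓ j) / a i) u| ≤ 1 / 2} := by
      refine measureReal_mono fun u hu i => ?_
      have e := hT3 _ hu.1 _ hu.2 i
      have e2 : X (fun j => T i j * (a j * ℓ j) / a i) u =
          ((f (h u) i : ℝ) - f (h (flip univ u)) i) / 2 := by
        have e3 := e.mul_right (1 / (2 * a i))
        have e4 : a i * ((f (h u) i : ℝ) - f (h (flip univ u)) i) * (1 / (2 * a i)) =
          ((f (h u) i : ℝ) - f (h (flip univ u)) i) / 2 := by
          have := (ha0 i).ne'; field_simp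
        rw [X, ← e4, ← e3.tsum_eq]
        refine tsum_congr fun j => ?_
        rw [hb, hb]
        have := (ha0 i).ne'
        have e5 : (flip univ u j : ℝ) = 1 - u j := by simp [flip]
        rw [e5, V]
        field_simp
        ring
      rw [e2, abs_le]
      constructor <;> linarith [(f (h u) i).2.1, (f (h u) i).2.2, (f (h (flip univ u)) i).2.1,
        (f (h (flip univ u)) i).2.2]
    linarith [min_le_left (ε / 2) (1 / 2)]
  obtain ⟨h1, h2, h3⟩ := hrow _ hs hgood
  exact ⟨h1, h2, h3⟩

/-- `φ_t(x) = log (1 + x / t)`. -/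
def phi (t x : ℝ) : ℝ := Real.log (1 + x / t)

/-- `ψ_t(x) = φ_t(x) - x φ_t'(x)`. -/
def psi (t x : ℝ) : ℝ := phi t x - x / (t + x)

lemma phi_nonneg {t x : ℝ} (ht : 0 < t) (hx : 0 ≤ x) : 0 ≤ phi t x :=
  Real.log_nonneg (by have := div_nonneg hx ht.le; linarith)

lemma phi_le_div {t x : ℝ} (ht : 0 < t) (hx : 0 ≤ x) : phi t x ≤ x / t := by
  have : 0 < 1 + x / t := by positivity
  linarith [Real.log_le_sub_one_of_pos this, show phi t x = Real.log (1 + x / t) from rfl]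

lemma phi_sub_phi {t x y : ℝ} (ht : 0 < t) (hx : 0 ≤ x) (hy : 0 ≤ y) :
    phi t x - phi t y = Real.log ((t + x) / (t + y)) := by
  rw [phi, phi, ← Real.log_div (by positivity) (by positivity)]
  congr 1
  field_simp

lemma phi_le_tangent {t x y : ℝ} (ht : 0 < t) (hx : 0 ≤ x) (hy : 0 ≤ y) :
    phi t x ≤ phi t y + (x - y) / (t + y) := by
  have h1 := phi_sub_phi ht hx hy
  have h2 := Real.log_le_sub_one_of_pos (show 0 < (t + x) / (t + y) by positivity)
  have h3 : (t + x) / (t + y) - 1 = (x - y) / (t + y) := by field_simp; ring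
  linarith

lemma psi_nonneg {t x : ℝ} (ht : 0 < t) (hx : 0 ≤ x) : 0 ≤ psi t x := by
  have h := phi_le_tangent ht le_rfl hx
  have h0 : phi t 0 = 0 := by simp [phi]
  rw [h0, zero_sub, neg_div] at h
  rw [psi]; linarith

lemma phi_sub_phi_le {t x y : ℝ} (ht : 0 < t) (hy : 0 < y) (hxy : y ≤ x) :
    phi t x - phi t y ≤ Real.log (x / y) := by
  have hx := hy.trans_le hxy
  rw [phi_sub_phi ht hx.le hy.le]
  refine Real.log_le_log (by positivity) ?_
  rw [div_le_div_iff₀ (by positivity) hy]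
  nlinarith

/-- A nonnegative matrix with unit column sums and row sums at most one, which maps the weights
`s` below the weights `A`. -/
structure Comparison (P : ℕ → ℕ → ℝ) (A s : ℕ → ℝ) (L : ℝ) : Prop where
  nonneg : ∀ i j, 0 ≤ P i j
  col : ∀ j, HasSum (fun i => P i j) 1
  row : ∀ i, Summable (P i)
  row_le : ∀ i, ∑' j, P i j ≤ 1
  pos : ∀ j, 0 < s j
  le : ∀ j, s j ≤ A j
  summable : Summable A
  sum_log : HasSum (fun j => Real.log (A j / s j)) L
  image_le : ∀ i, ∑' j, P i j * s j ≤ A i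

namespace Comparison

variable {P : ℕ → ℕ → ℝ} {A s : ℕ → ℝ} {L : ℝ}

/-- The defect of the `i`-th row. -/
def defect (P : ℕ → ℕ → ℝ) (A s : ℕ → ℝ) (t : ℝ) (i : ℕ) : ℝ :=
  phi t (A i) - ∑' j, P i j * phi t (s j)

lemma A_pos (h : Comparison P A s L) (j : ℕ) : 0 < A j := (h.pos j).trans_le (h.le j)

lemma summable_s (h : Comparison P A s L) : Summable s :=
  h.summable.of_nonneg_of_le (fun j => (h.pos j).le) h.le

lemma entry_le (h : Comparison P A s L) (i j : ℕ) : P i j ≤ 1 :=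
  le_hasSum (h.col j) i fun k _ => h.nonneg k j

lemma summable_mul (h : Comparison P A s L) {c : ℕ → ℝ} (hc0 : ∀ j, 0 ≤ c j) (hc : Summable c)
    (i : ℕ) : Summable fun j => P i j * c j :=
  hc.of_nonneg_of_le (fun j => mul_nonneg (h.nonneg i j) (hc0 j))
    fun j => mul_le_of_le_one_left (hc0 j) (h.entry_le i j)

lemma hasSum_rows (h : Comparison P A s L) {c : ℕ → ℝ} (hc0 : ∀ j, 0 ≤ c j) (hc : Summable c) :
    HasSum (fun i => ∑' j, P i j * c j) (∑' j, c j) := by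
  have hsum : Summable fun p : ℕ × ℕ => P p.2 p.1 * c p.1 := by
    refine (summable_prod_of_nonneg fun p => mul_nonneg (h.nonneg _ _) (hc0 _)).2 ⟨fun j => ?_, ?_⟩
    · exact (h.col j).summable.mul_right (c j)
    · simpa [tsum_mul_right, (h.col _).tsum_eq] using hc
  have h1 : HasSum (fun p : ℕ × ℕ => P p.1 p.2 * c p.2) (∑' p : ℕ × ℕ, P p.2 p.1 * c p.1) :=
    (Equiv.prodComm ℕ ℕ).hasSum_iff.1 hsum.hasSum
  have h2 := h1.prod_fiberwise fun i => (h.summable_mul hc0 hc i).hasSum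
  rwa [hsum.tsum_prod, tsum_congr fun j => ?_] at h2
  change ∑' i, P i j * c j = c j
  rw [tsum_mul_right, (h.col j).tsum_eq, one_mul]

lemma summable_phi (h : Comparison P A s L) {t : ℝ} (ht : 0 < t) :
    Summable fun j => phi t (s j) :=
  (h.summable_s.div_const t).of_nonneg_of_le (fun j => phi_nonneg ht (h.pos j).le)
    fun j => phi_le_div ht (h.pos j).le

lemma summable_phi' (h : Comparison P A s L) {t : ℝ} (ht : 0 < t) :
    Summable fun j => phi t (A j) :=
  (h.summable.div_const t).of_nonneg_of_le (fun j => phi_nonneg ht (h.A_pos j).le)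
    fun j => phi_le_div ht (h.A_pos j).le

/-- Tangents at `A i`. -/
lemma le_defect (h : Comparison P A s L) {t : ℝ} (ht : 0 < t) (i : ℕ) :
    (1 - ∑' j, P i j) * psi t (A i) + (A i - ∑' j, P i j * s j) / (t + A i) ≤
      defect P A s t i := by
  have hA := h.A_pos i
  have h1 : ∑' j, P i j * phi t (s j) ≤
      ∑' j, (P i j * (phi t (A i) - A i / (t + A i)) + P i j * s j * (1 / (t + A i))) := by
    refine (h.summable_mul (fun j => phi_nonneg ht (h.pos j).le) (h.summable_phi ht) i).tsum_le_tsum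
      (fun j => ?_) (((h.row i).mul_right _).add
        ((h.summable_mul (fun j => (h.pos j).le) h.summable_s i).mul_right _))
    have := mul_le_mul_of_nonneg_left (phi_le_tangent ht (h.pos j).le hA.le) (h.nonneg i j)
    refine this.trans_eq ?_
    ring
  rw [Summable.tsum_add ((h.row i).mul_right _)
        ((h.summable_mul (fun j => (h.pos j).le) h.summable_s i).mul_right _),
    tsum_mul_right, tsum_mul_right] at h1
  rw [defect, psi]
  have e : (A i - ∑' j, P i j * s j) / (t + A i) =
    A i / (t + A i) - (∑' j, P i j * s j) * (1 / (t + A i)) := by ring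
  rw [e]
  linarith

lemma defect_nonneg (h : Comparison P A s L) {t : ℝ} (ht : 0 < t) (i : ℕ) :
    0 ≤ defect P A s t i := by
  refine le_trans (add_nonneg (mul_nonneg ?_ (psi_nonneg ht (h.A_pos i).le)) (div_nonneg ?_ ?_))
    (h.le_defect ht i)
  · linarith [h.row_le i]
  · linarith [h.image_le i]
  · linarith [h.A_pos i]

lemma sum_defect_le (h : Comparison P A s L) {t : ℝ} (ht : 0 < t) (Z : Finset ℕ) :
    ∑ i ∈ Z, defect P A s t i ≤ L := by
  have h1 := (h.summable_phi' ht).hasSum.sub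
    (h.hasSum_rows (fun j => phi_nonneg ht (h.pos j).le) (h.summable_phi ht))
  refine (sum_le_hasSum Z (fun i _ => h.defect_nonneg ht i) h1).trans ?_
  rw [← (h.summable_phi' ht).tsum_sub (h.summable_phi ht), ← h.sum_log.tsum_eq]
  exact ((h.summable_phi' ht).sub (h.summable_phi ht)).tsum_le_tsum
    (fun j => phi_sub_phi_le ht (h.pos j) (h.le j)) h.sum_log.summable

/-- Tangents at `A i` for the entry `k` and at `θ A i` for the others. -/
lemma le_defect_of_entry (h : Comparison P A s L) {t : ℝ} (ht : 0 < t) (i k : ℕ) {θ : ℝ}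
    (hθ : 0 < θ) :
    (1 - P i k) * (psi t (A i) - psi t (θ * A i)) -
      (∑' j, P i j * s j - P i k * s k) / (θ * A i) ≤ defect P A s t i := by
  have hA := h.A_pos i
  have hθA : 0 < θ * A i := mul_pos hθ hA
  have hsm := h.summable_mul (fun j => (h.pos j).le) h.summable_s i
  set y := θ * A i
  have h1 : ∑' j, P i j * phi t (s j) - P i k * phi t (s k) ≤
      (∑' j, P i j - P i k) * psi t y + (∑' j, P i j * s j - P i k * s k) * (1 / (t + y)) := by
    have hp := h.summable_mul (fun j => phi_nonneg ht (h.pos j).le) (h.summable_phi ht) i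
    have e := fun {g : ℕ → ℝ} (hg : Summable g) => hg.tsum_eq_add_tsum_ite k
    rw [e hp, e (h.row i), e hsm]
    simp only [add_sub_cancel_left]
    have hs1 : ∀ {g : ℕ → ℝ}, Summable g → Summable fun j => if j = k then 0 else g j := by
      intro g hg
      exact Summable.of_norm_bounded hg.norm fun j => by split_ifs <;> simp
    rw [← tsum_mul_right, ← tsum_mul_right,
      ← Summable.tsum_add ((hs1 (h.row i)).mul_right _) ((hs1 hsm).mul_right _)]
    refine (hs1 hp).tsum_le_tsum (fun j => ?_)
      (((hs1 (h.row i)).mul_right _).add ((hs1 hsm).mul_right _))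
    split_ifs
    · simp
    · have := mul_le_mul_of_nonneg_left (phi_le_tangent ht (h.pos j).le hθA.le) (h.nonneg i j)
      refine this.trans_eq ?_
      rw [psi]; ring
  have h2 : P i k * phi t (s k) ≤ P i k * phi t (A i) + (1 - P i k) * (A i / (t + A i)) := by
    have := mul_le_mul_of_nonneg_left (phi_le_tangent ht (h.pos k).le hA.le) (h.nonneg i k)
    have h3 : P i k * s k ≤ A i := (hsm.le_tsum k fun j _ =>
      mul_nonneg (h.nonneg i j) (h.pos j).le).trans (h.image_le i)
    have h4 : P i k * ((s k - A i) / (t + A i)) ≤ (1 - P i k) * (A i / (t + A i)) := by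
      rw [← mul_div_assoc, ← mul_div_assoc]
      refine div_le_div_of_nonneg_right ?_ (by positivity)
      rw [mul_sub, sub_mul]
      linarith
    linarith
  have h5 : (∑' j, P i j - P i k) * psi t y ≤ (1 - P i k) * psi t y :=
    mul_le_mul_of_nonneg_right (by linarith [h.row_le i]) (psi_nonneg ht hθA.le)
  have h6 : (∑' j, P i j * s j - P i k * s k) * (1 / (t + y)) ≤
      (∑' j, P i j * s j - P i k * s k) / y := by
    rw [div_eq_mul_one_div _ y]
    have : 0 ≤ ∑' j, P i j * s j - P i k * s k := sub_nonneg.2 (hsm.le_tsum k fun j _ =>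
      mul_nonneg (h.nonneg i j) (h.pos j).le)
    gcongr
    linarith
  have e1 : psi t (A i) = phi t (A i) - A i / (t + A i) := rfl
  rw [defect, e1]
  linarith

lemma tendsto_div_add {x : ℝ} (hx : 0 < x) :
    Tendsto (fun t => x / (t + x)) (𝓝[>] 0) (𝓝 1) := by
  have : ContinuousAt (fun t => x / (t + x)) 0 := by
    refine continuousAt_const.div (by fun_prop) (by simpa using hx.ne')
  simpa [hx.ne'] using this.tendsto.mono_left nhdsWithin_le_nhds

lemma tendsto_psi_sub {x θ : ℝ} (hx : 0 < x) (hθ : 0 < θ) :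
    Tendsto (fun t => psi t x - psi t (θ * x)) (𝓝[>] 0) (𝓝 (-Real.log θ)) := by
  have hy : 0 < θ * x := mul_pos hθ hx
  have h1 : Tendsto (fun t => Real.log ((t + x) / (t + θ * x))) (𝓝[>] 0) (𝓝 (-Real.log θ)) := by
    have : ContinuousAt (fun t => Real.log ((t + x) / (t + θ * x))) 0 := by
      refine ContinuousAt.log (ContinuousAt.div (by fun_prop) (by fun_prop) (by simpa using hy.ne'))
        (by simp; exact ⟨hx.ne', hθ.ne', hx.ne'⟩)
    have h := this.tendsto.mono_left (nhdsWithin_le_nhds (s := Ioi 0))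
    have e : (0 + x) / (0 + θ * x) = θ⁻¹ := by
      have := hx.ne'; have := hθ.ne'; field_simp; ring
    rwa [e, Real.log_inv] at h
  have h2 := (h1.sub (tendsto_div_add hx)).add (tendsto_div_add hy)
  rw [sub_add_cancel] at h2
  refine h2.congr' ?_
  filter_upwards [self_mem_nhdsWithin] with t ht
  rw [← phi_sub_phi ht hx.le hy.le, psi, psi]
  ring

lemma tendsto_psi {x : ℝ} (hx : 0 < x) : Tendsto (fun t => psi t x) (𝓝[>] 0) atTop := by
  have h1 : Tendsto (fun t => phi t x) (𝓝[>] 0) atTop := by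
    refine Real.tendsto_log_atTop.comp (tendsto_atTop_add_const_left _ _ ?_)
    exact (tendsto_inv_nhdsGT_zero.const_mul_atTop hx).congr fun t => (div_eq_mul_inv x t).symm
  exact h1.atTop_add (C := -1) (tendsto_div_add hx).neg

/-- The rows lose little mass. -/
lemma sum_loss_le (h : Comparison P A s L) (Z : Finset ℕ) :
    ∑ i ∈ Z, (1 - (∑' j, P i j * s j) / A i) ≤ L := by
  have ht : Tendsto (fun t => ∑ i ∈ Z, (A i / (t + A i)) * (1 - (∑' j, P i j * s j) / A i))
      (𝓝[>] 0) (𝓝 (∑ i ∈ Z, 1 * (1 - (∑' j, P i j * s j) / A i))) :=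
    tendsto_finsetSum _ fun i _ => (tendsto_div_add (h.A_pos i)).mul_const _
  simp only [one_mul] at ht
  refine le_of_tendsto ht ?_
  filter_upwards [self_mem_nhdsWithin] with t ht
  refine le_trans (Finset.sum_le_sum fun i _ => ?_) (h.sum_defect_le ht Z)
  refine le_trans ?_ (h.le_defect ht i)
  have h1 : 0 ≤ (1 - ∑' j, P i j) * psi t (A i) :=
    mul_nonneg (by linarith [h.row_le i]) (psi_nonneg ht (h.A_pos i).le)
  have h2 : A i / (t + A i) * (1 - (∑' j, P i j * s j) / A i) =
      (A i - ∑' j, P i j * s j) / (t + A i) := by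
    have := (h.A_pos i).ne'
    field_simp
  linarith

/-- The rows are concentrated on any choice of dominant entries, up to the remaining mass. -/
lemma sum_entry_loss_le (h : Comparison P A s L) (Z : Finset ℕ) (k : ℕ → ℕ) :
    ∑ i ∈ Z, (4 * (1 - P i (k i)) -
      Real.exp 4 * ((∑' j, P i j * s j - P i (k i) * s (k i)) / A i)) ≤ L := by
  have ht : Tendsto (fun t => ∑ i ∈ Z, ((1 - P i (k i)) *
      (psi t (A i) - psi t (Real.exp (-4) * A i)) -
        Real.exp 4 * ((∑' j, P i j * s j - P i (k i) * s (k i)) / A i))) (𝓝[>] 0)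
      (𝓝 (∑ i ∈ Z, ((1 - P i (k i)) * -Real.log (Real.exp (-4)) -
        Real.exp 4 * ((∑' j, P i j * s j - P i (k i) * s (k i)) / A i)))) :=
    tendsto_finsetSum _ fun i _ => ((tendsto_psi_sub (h.A_pos i) (Real.exp_pos _)).const_mul _).sub
      tendsto_const_nhds
  simp only [Real.log_exp, neg_neg, mul_comm _ (4 : ℝ)] at ht
  refine le_of_tendsto ht ?_
  filter_upwards [self_mem_nhdsWithin] with t ht
  refine le_trans (Finset.sum_le_sum fun i _ => ?_) (h.sum_defect_le ht Z)
  refine le_trans (le_of_eq ?_) (h.le_defect_of_entry ht i (k i) (Real.exp_pos (-4)))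
  rw [Real.exp_neg]
  have := (h.A_pos i).ne'
  have := (Real.exp_pos 4).ne'
  field_simp

/-- All row sums equal one. -/
lemma row_eq_one (h : Comparison P A s L) (i : ℕ) : ∑' j, P i j = 1 := by
  by_contra hne
  have hlt : 0 < 1 - ∑' j, P i j := by linarith [lt_of_le_of_ne (h.row_le i) hne]
  have h1 := (tendsto_psi (h.A_pos i)).const_mul_atTop hlt
  obtain ⟨t, h2, ht⟩ := ((h1.eventually_gt_atTop L).and self_mem_nhdsWithin).exists
  have h3 := h.le_defect ht i
  have h4 := h.sum_defect_le ht {i}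
  rw [Finset.sum_singleton] at h4
  have h5 : 0 ≤ (A i - ∑' j, P i j * s j) / (t + A i) := by
    have ht : 0 < t := ht
    refine div_nonneg (by linarith [h.image_le i]) (by linarith [h.A_pos i])
  linarith

end Comparison

lemma tsum_sq_eq_sq_add_rest {c : ℕ → ℝ} (hc : Summable fun j => c j ^ 2) (k : ℕ) :
    ∑' j, c j ^ 2 = c k ^ 2 + rest c k := by
  rw [hc.tsum_eq_add_tsum_ite k, rest]
  congr 1
  refine tsum_congr fun j => ?_
  by_cases h : j = k <;> simp [h]

/-- Common factors absorbing the excesses of all rows with the same dominant entry. -/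
lemma exists_summable_scale {e : ℕ → ℝ} (he : ∀ i, 0 ≤ e i ∧ e i ≤ 1 / 200) (σ : ℕ → ℕ) {C : ℝ}
    (hsum : ∀ R : Finset ℕ, InjOn σ R → (∀ i ∈ R, 0 < e i) → ∑ i ∈ R, e i ≤ C) :
    ∃ l : ℕ → ℝ, (∀ j, 0 ≤ l j ∧ l j ≤ 1 / 100) ∧ (∀ i, 2 * e i ≤ l (σ i)) ∧ Summable l := by
  classical
  let g : ℕ → ℕ → ℝ := fun j i => if σ i = j then e i else 0
  have hg0 : ∀ j i, 0 ≤ g j i := fun j i => by simp only [g]; split_ifs; exacts [(he i).1, le_rfl]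
  have hg1 : ∀ j i, g j i ≤ 1 / 200 := fun j i => by
    simp only [g]; split_ifs; exacts [(he i).2, by norm_num]
  have hbd : ∀ j, BddAbove (range (g j)) := fun j => ⟨1 / 200, by rintro _ ⟨i, rfl⟩; exact hg1 j i⟩
  have hs0 : ∀ j, 0 ≤ ⨆ i, g j i := fun j => (hg0 j 0).trans (le_ciSup (hbd j) 0)
  refine ⟨fun j => 2 * ⨆ i, g j i, fun j => ⟨by have := hs0 j; positivity, ?_⟩, fun i => ?_, ?_⟩
  · have : ⨆ i, g j i ≤ 1 / 200 := ciSup_le (hg1 j)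
    linarith
  · have := le_ciSup (hbd (σ i)) i
    simp only [g, if_true] at this
    linarith
  · refine summable_of_sum_le (c := 4 * C) (fun j => by have := hs0 j; positivity) fun F => ?_
    have hex : ∀ j, 0 < ⨆ i, g j i → ∃ i, σ i = j ∧ (⨆ i, g j i) / 2 < e i := fun j hj => by
      obtain ⟨i, hi⟩ := exists_lt_of_lt_ciSup (half_lt_self hj)
      by_cases hij : σ i = j
      · exact ⟨i, hij, by simpa [g, hij] using hi⟩
      · simp only [g, hij, if_false] at hi; linarith
    choose! r hr1 hr2 using hex
    set F' := F.filter fun j => 0 < ⨆ i, g j i with hF'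
    have hpos : ∀ j ∈ F', 0 < ⨆ i, g j i := fun j hj => (Finset.mem_filter.1 hj).2
    have hinj : InjOn r F' := fun j hj k hk hjk => by
      rw [← hr1 j (hpos j hj), ← hr1 k (hpos k hk), hjk]
    have h1 := hsum (F'.image r) (by
      intro x hx y hy hxy
      obtain ⟨j, hj, rfl⟩ := Finset.mem_image.1 (Finset.mem_coe.1 hx)
      obtain ⟨k, hk, rfl⟩ := Finset.mem_image.1 (Finset.mem_coe.1 hy)
      rw [hr1 j (hpos j hj), hr1 k (hpos k hk)] at hxy
      rw [hxy]) (by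
      intro i hi
      obtain ⟨j, hj, rfl⟩ := Finset.mem_image.1 hi
      linarith [hr2 j (hpos j hj), hpos j hj])
    rw [Finset.sum_image hinj] at h1
    have h2 : ∑ j ∈ F, 2 * ⨆ i, g j i = ∑ j ∈ F', 2 * ⨆ i, g j i := by
      rw [hF', Finset.sum_filter]
      refine Finset.sum_congr rfl fun j _ => ?_
      split_ifs with h
      · rfl
      · rw [le_antisymm (not_lt.1 h) (hs0 j), mul_zero]
    rw [h2]
    calc ∑ j ∈ F', 2 * ⨆ i, g j i ≤ ∑ j ∈ F', 4 * e (r j) :=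
          Finset.sum_le_sum fun j hj => by linarith [hr2 j (hpos j hj)]
      _ ≤ 4 * C := by rw [← Finset.mul_sum]; linarith

/-- The total excess of rows with distinct dominant entries. -/
lemma RowStructure.sum_excess_tsum_le {M : ℕ → ℕ → ℝ} (h : RowStructure M)
    (hM : ∀ i, Summable fun j => M i j ^ 2) {σ : ℕ → ℕ} (R : Finset ℕ) (hinj : InjOn σ R)
    (hR : ∀ i ∈ R, 1 < ∑' j, M i j ^ 2)
    (hσ : ∀ i ∈ R, |M i (σ i)| ≤ 1 + 1 / 512 ∧ √(rest (M i) (σ i)) ≤ 1 / 32) :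
    ∑ i ∈ R, (∑' j, M i j ^ 2 - 1) ≤ 16 := by
  have hr := fun i => Real.sqrt_nonneg (rest (M i) (σ i))
  have hsq : ∀ i, ∑' j, M i j ^ 2 = |M i (σ i)| ^ 2 + √(rest (M i) (σ i)) ^ 2 := fun i => by
    rw [tsum_sq_eq_sq_add_rest (hM i) (σ i), sq_abs, Real.sq_sqrt (rest_nonneg _ _)]
  have hrr : ∀ i ∈ R, √(rest (M i) (σ i)) ^ 2 ≤ √(rest (M i) (σ i)) / 32 := fun i hi => by
    nlinarith [hσ i hi, hr i]
  have h1 := h.sum_rest_le R σ hinj fun i hi => by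
    refine ⟨(hσ i hi).2, ?_⟩
    have := hR i hi
    rw [hsq] at this
    have := hrr i hi
    by_contra! hlt
    nlinarith [abs_nonneg (M i (σ i)), hr i, (hσ i hi).2]
  have h2 := h.sum_excess_le (R.filter fun i => 1 ≤ |M i (σ i)|) σ
    (hinj.mono (Finset.coe_subset.2 (Finset.filter_subset _ _))) fun i hi => by
      obtain ⟨hi, h1⟩ := Finset.mem_filter.1 hi
      exact ⟨h1, by linarith [(hσ i hi).1]⟩
  rw [Finset.sum_filter] at h2
  have h3 : ∀ i ∈ R, ∑' j, M i j ^ 2 - 1 ≤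
      3 * (if 1 ≤ |M i (σ i)| then |M i (σ i)| - 1 else 0) + √(rest (M i) (σ i)) / 32 := by
    intro i hi
    have := hrr i hi
    rw [hsq]
    split_ifs with h
    · nlinarith [hσ i hi]
    · nlinarith [abs_nonneg (M i (σ i))]
  refine (Finset.sum_le_sum h3).trans ?_
  rw [Finset.sum_add_distrib, ← Finset.mul_sum, ← Finset.sum_div]
  linarith

/-- After a summable shrinking of the weights the matrix of squares becomes a comparison. -/
lemma exists_comparison {T : ℕ → ℕ → ℝ} {a ℓ : ℕ → ℝ} (ha0 : ∀ i, 0 < a i)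
    (ha : Summable fun i => a i ^ 2) (hcol : ∀ j, HasSum (fun i => T i j ^ 2) 1)
    (hrow : ∀ i, Summable (fun j => T i j ^ 2) ∧ ∑' j, T i j ^ 2 ≤ 1)
    (hℓ : ∀ j, 0 < ℓ j ∧ ℓ j ≤ 1) (hn : ∃ n, ∀ j ≥ n, ℓ j = 1)
    (h : RowStructure fun i j => T i j * (a j * ℓ j) / a i) :
    ∃ s L, Comparison (fun i j => T i j ^ 2) (fun i => a i ^ 2) s L ∧
      ∀ j, s j ≤ (a j * ℓ j) ^ 2 := by
  classical
  have hb0 : ∀ j, 0 < a j * ℓ j := fun j => mul_pos (ha0 j) (hℓ j).1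
  have hba : ∀ j, (a j * ℓ j) ^ 2 ≤ a j ^ 2 := fun j => by
    rw [mul_pow]
    exact mul_le_of_le_one_right (sq_nonneg _) (pow_le_one₀ (hℓ j).1.le (hℓ j).2)
  have hb : Summable fun j => (a j * ℓ j) ^ 2 := ha.of_nonneg_of_le (fun _ => sq_nonneg _) hba
  have hT1 : ∀ i j, T i j ^ 2 ≤ 1 := fun i j => le_hasSum (hcol j) i fun _ _ => sq_nonneg _
  have hTb : ∀ i, Summable fun j => T i j ^ 2 * (a j * ℓ j) ^ 2 := fun i =>
    hb.of_nonneg_of_le (fun j => by positivity) fun j =>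
      mul_le_of_le_one_left (sq_nonneg _) (hT1 i j)
  set M : ℕ → ℕ → ℝ := fun i j => T i j * (a j * ℓ j) / a i with hMdef
  have hM2 : ∀ i j, M i j ^ 2 = T i j ^ 2 * (a j * ℓ j) ^ 2 / a i ^ 2 := fun i j => by
    rw [hMdef]; ring
  have hM : ∀ i, Summable fun j => M i j ^ 2 := fun i => by
    simp only [hM2]; exact (hTb i).div_const _
  have hMt : ∀ i, ∑' j, M i j ^ 2 = (∑' j, T i j ^ 2 * (a j * ℓ j) ^ 2) / a i ^ 2 := fun i => by
    simp only [hM2, tsum_div_const]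
  choose! σ hσ1 hσ2 hσ3 using h.exists_dominant
  have hexc : ∀ i, ∑' j, M i j ^ 2 - 1 ≤ 1 / 200 := fun i => by
    by_cases hd : 1 - 1 / 4096 ≤ ∑' j, M i j ^ 2
    · have h2 := hσ2 i hd
      have h3 := hσ3 i hd
      have h4 := Real.sqrt_nonneg (rest (M i) (σ i))
      have h5 := Real.sq_sqrt (rest_nonneg (M i) (σ i))
      rw [tsum_sq_eq_sq_add_rest (hM i) (σ i), ← sq_abs, ← h5]
      nlinarith [abs_nonneg (M i (σ i))]
    · linarith
  obtain ⟨l, hl, hle, hls⟩ := exists_summable_scale (e := fun i => max (∑' j, M i j ^ 2 - 1) 0)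
    (σ := σ) (C := 16) (fun i => ⟨le_max_right _ _, max_le (hexc i) (by norm_num)⟩) (by
      intro R hinj hR
      have hR' : ∀ i ∈ R, 1 < ∑' j, M i j ^ 2 := fun i hi => by
        have := hR i hi
        rcases lt_max_iff.1 this with h | h
        · linarith
        · exact absurd h (lt_irrefl _)
      refine (Finset.sum_congr rfl fun i hi => max_eq_left ?_).trans_le
        (h.sum_excess_tsum_le hM R hinj hR' fun i hi => ?_)
      · linarith [hR' i hi]
      · have : 1 - 1 / 4096 ≤ ∑' j, M i j ^ 2 := by linarith [hR' i hi]
        exact ⟨hσ2 i this, hσ3 i this⟩)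
  have hl1 : ∀ j, 0 < 1 - l j ∧ 1 - l j ≤ 1 := fun j => by
    constructor <;> linarith [hl j]
  have hsb : ∀ j, (1 - l j) * (a j * ℓ j) ^ 2 ≤ (a j * ℓ j) ^ 2 := fun j =>
    mul_le_of_le_one_left (sq_nonneg _) (hl1 j).2
  have hlogs : Summable fun j => Real.log (a j ^ 2 / ((1 - l j) * (a j * ℓ j) ^ 2)) := by
    have e : ∀ j, Real.log (a j ^ 2 / ((1 - l j) * (a j * ℓ j) ^ 2)) =
        -Real.log (1 - l j) + -(2 * Real.log (ℓ j)) := fun j => by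
      have h1 : a j ^ 2 / ((1 - l j) * (a j * ℓ j) ^ 2) = ((1 - l j) * ℓ j ^ 2)⁻¹ := by
        have := (ha0 j).ne'; have := (hℓ j).1.ne'; have := (hl1 j).1.ne'
        field_simp
      rw [h1, Real.log_inv, Real.log_mul (hl1 j).1.ne' (by have := (hℓ j).1; positivity),
        Real.log_pow]
      push_cast; ring
    simp only [e]
    refine Summable.add ?_ ?_
    · refine (hls.mul_left 2).of_nonneg_of_le
        (fun j => neg_nonneg.2 (Real.log_nonpos (hl1 j).1.le (hl1 j).2)) fun j => ?_
      have h1 := Real.one_sub_inv_le_log_of_pos (hl1 j).1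
      have h2 : (1 - l j)⁻¹ ≤ 1 + 2 * l j := by
        rw [inv_le_iff_one_le_mul₀ (hl1 j).1]
        nlinarith [hl j]
      linarith
    · obtain ⟨n, hn⟩ := hn
      refine summable_of_ne_finset_zero (s := Finset.range n) fun j hj => ?_
      rw [hn j (by simpa using hj)]; simp
  refine ⟨fun j => (1 - l j) * (a j * ℓ j) ^ 2, _, ⟨fun _ _ => sq_nonneg _, hcol,
    fun i => (hrow i).1, fun i => (hrow i).2, fun j => ?_, fun j => (hsb j).trans (hba j), ha,
    hlogs.hasSum, fun i => ?_⟩, hsb⟩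
  · have := hb0 j; have := (hl1 j).1; positivity
  · have hai : 0 < a i ^ 2 := by have := ha0 i; positivity
    have hTs : Summable fun j => T i j ^ 2 * ((1 - l j) * (a j * ℓ j) ^ 2) :=
      (hTb i).of_nonneg_of_le (fun j => mul_nonneg (sq_nonneg _)
        (mul_nonneg (hl1 j).1.le (sq_nonneg _)))
        fun j => mul_le_mul_of_nonneg_left (hsb j) (sq_nonneg _)
    have hTl : Summable fun j => T i j ^ 2 * (a j * ℓ j) ^ 2 * l j := by
      refine ((hTb i).sub hTs).congr fun j => ?_
      ring
    have e1 : ∑' j, T i j ^ 2 * ((1 - l j) * (a j * ℓ j) ^ 2) =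
        ∑' j, T i j ^ 2 * (a j * ℓ j) ^ 2 - ∑' j, T i j ^ 2 * (a j * ℓ j) ^ 2 * l j := by
      rw [← (hTb i).tsum_sub hTl]
      exact tsum_congr fun j => by ring
    have hnn : ∀ j, 0 ≤ T i j ^ 2 * (a j * ℓ j) ^ 2 * l j := fun j =>
      mul_nonneg (by positivity) (hl j).1
    have e2 : ∑' j, T i j ^ 2 * (a j * ℓ j) ^ 2 = (∑' j, M i j ^ 2) * a i ^ 2 := by
      rw [hMt, div_mul_cancel₀ _ hai.ne']
    rw [e1, e2]
    by_cases hv : ∑' j, M i j ^ 2 ≤ 1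
    · have : 0 ≤ ∑' j, T i j ^ 2 * (a j * ℓ j) ^ 2 * l j := tsum_nonneg hnn
      nlinarith
    · have hd : 1 - 1 / 4096 ≤ ∑' j, M i j ^ 2 := by linarith
      have h1 := hTl.le_tsum (σ i) fun j _ => hnn j
      have h2 : T i (σ i) ^ 2 * (a (σ i) * ℓ (σ i)) ^ 2 = |M i (σ i)| ^ 2 * a i ^ 2 := by
        rw [sq_abs, hM2, div_mul_cancel₀ _ hai.ne']
      rw [h2] at h1
      have h3 := hle i
      rw [max_eq_left (by linarith)] at h3
      have h4 : 1 / 2 ≤ |M i (σ i)| ^ 2 := by nlinarith [hσ1 i hd]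
      have h5 : ∑' j, M i j ^ 2 - 1 ≤ |M i (σ i)| ^ 2 * l (σ i) := by
        nlinarith [(hl (σ i)).1]
      nlinarith
lemma summable_ite_of_sum_le {f : ℕ → ℝ} {p : ℕ → Prop} [DecidablePred p] (hf : ∀ i, p i → 0 ≤ f i)
    {C : ℝ} (h : ∀ Z : Finset ℕ, (∀ i ∈ Z, p i) → ∑ i ∈ Z, f i ≤ C) :
    Summable fun i => if p i then f i else 0 := by
  refine summable_of_sum_le (c := C) (fun i => ?_) fun F => ?_
  · simp only [Pi.zero_apply]
    split_ifs with hi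
    exacts [hf i hi, le_rfl]
  · rw [← Finset.sum_filter]
    exact h _ fun i hi => (Finset.mem_filter.1 hi).2

/-- Apart from finitely many rows, the matrix is concentrated on an injective choice of entries. -/
lemma exists_concentration {T : ℕ → ℕ → ℝ} {a b : ℕ → ℝ} {s : ℕ → ℝ} {L : ℝ} (ha0 : ∀ i, 0 < a i)
    (hb : Summable fun j => b j ^ 2)
    (hP : Comparison (fun i j => T i j ^ 2) (fun i => a i ^ 2) s L) (hsb : ∀ j, s j ≤ b j ^ 2)
    (h : RowStructure fun i j => T i j * b j / a i) :
    ∃ (B : Finset ℕ) (σ : ℕ → ℕ), InjOn σ {i | i ∉ B} ∧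
      (∀ i, i ∉ B → 1 / 2 < T i (σ i) ^ 2 ∧ 1 / 4 ≤ (T i (σ i) * b (σ i) / a i) ^ 2) ∧
      (Summable fun i => if i ∉ B then 1 - T i (σ i) ^ 2 else 0) ∧
      (Summable fun i => if i ∉ B then rest (fun j => T i j * b j / a i) (σ i) else 0) := by
  classical
  have ha2 : ∀ i, 0 < a i ^ 2 := fun i => by have := ha0 i; positivity
  set M : ℕ → ℕ → ℝ := fun i j => T i j * b j / a i with hMdef
  have hM2 : ∀ i j, M i j ^ 2 = T i j ^ 2 * b j ^ 2 / a i ^ 2 := fun i j => by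
    rw [hMdef]; ring
  have hTb := fun i => hP.summable_mul (fun j => sq_nonneg (b j)) hb i
  have hTs := fun i => hP.summable_mul (fun j => (hP.pos j).le) hP.summable_s i
  have hM : ∀ i, Summable fun j => M i j ^ 2 := fun i => by
    simp only [hM2]; exact (hTb i).div_const _
  set v : ℕ → ℝ := fun i => (∑' j, T i j ^ 2 * s j) / a i ^ 2 with hv
  have hv1 : ∀ i, v i ≤ 1 := fun i => (div_le_one (ha2 i)).2 (hP.image_le i)
  have hvM : ∀ i, v i ≤ ∑' j, M i j ^ 2 := fun i => by
    simp only [hv, hM2, tsum_div_const]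
    refine div_le_div_of_nonneg_right ?_ (ha2 i).le
    exact (hTs i).tsum_le_tsum (fun j => mul_le_mul_of_nonneg_left (hsb j) (sq_nonneg _)) (hTb i)
  have hvs : Summable fun i => 1 - v i :=
    summable_of_sum_le (c := L) (fun i => by simpa using hv1 i) fun Z => hP.sum_loss_le Z
  choose! σ hσ1 hσ2 hσ3 using h.exists_dominant
  have hw : ∀ i, (∑' j, T i j ^ 2 * s j - T i (σ i) ^ 2 * s (σ i)) / a i ^ 2 ≤
      rest (M i) (σ i) := fun i => by
    have e := tsum_sq_eq_sq_add_rest (hM i) (σ i)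
    have e2 : rest (M i) (σ i) =
        (∑' j, T i j ^ 2 * b j ^ 2 - T i (σ i) ^ 2 * b (σ i) ^ 2) / a i ^ 2 := by
      rw [sub_div, ← hM2, ← tsum_div_const]
      simp only [← hM2]
      linarith
    rw [e2]
    refine div_le_div_of_nonneg_right ?_ (ha2 i).le
    rw [(hTs i).tsum_eq_add_tsum_ite (σ i), (hTb i).tsum_eq_add_tsum_ite (σ i),
      add_sub_cancel_left, add_sub_cancel_left]
    refine Summable.tsum_le_tsum (fun j => ?_)
      (Summable.of_norm_bounded (hTs i).norm fun j => by
        split_ifs <;> simp only [norm_zero, norm_nonneg, le_refl])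
      (Summable.of_norm_bounded (hTb i).norm fun j => by
        split_ifs <;> simp only [norm_zero, norm_nonneg, le_refl])
    split_ifs
    exacts [le_rfl, mul_le_mul_of_nonneg_left (hsb j) (sq_nonneg _)]
  have hexp : Real.exp 4 < 64 := by
    have e : Real.exp 4 = Real.exp 1 ^ 4 := by rw [← Real.exp_nat_mul]; norm_num
    have h1 := Real.exp_one_lt_d9
    have h2 : Real.exp 1 ^ 4 < 2.8 ^ 4 :=
      pow_lt_pow_left₀ (h1.trans (by norm_num)) (Real.exp_pos _).le (by norm_num)
    rw [e]
    exact h2.trans (by norm_num)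
  have hr := fun i => Real.sqrt_nonneg (rest (M i) (σ i))
  have hrsq := fun i => Real.sq_sqrt (rest_nonneg (M i) (σ i))
  have hent := fun (Z : Finset ℕ) => hP.sum_entry_loss_le Z σ
  have hS : Summable fun i => if 1 - 1 / 4096 ≤ ∑' j, M i j ^ 2 ∧ T i (σ i) ^ 2 ≤ 1 / 2 then
      (1 : ℝ) else 0 := by
    refine summable_ite_of_sum_le (C := L) (fun _ _ => zero_le_one) fun Z hZ => ?_
    refine (Finset.sum_le_sum fun i hi => ?_).trans (hent Z)
    have h1 := hw i
    have h2 := hσ3 i (hZ i hi).1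
    have h3 := hr i
    have h4 : rest (M i) (σ i) ≤ 1 / 1024 := by rw [← hrsq]; nlinarith
    have h5 := (hZ i hi).2
    have h6 : Real.exp 4 * ((∑' j, T i j ^ 2 * s j - T i (σ i) ^ 2 * s (σ i)) / a i ^ 2) ≤
        Real.exp 4 * (1 / 1024) :=
      mul_le_mul_of_nonneg_left (h1.trans h4) (Real.exp_pos _).le
    linarith
  have hfin : {i | ¬ (1 - 1 / 4096 ≤ ∑' j, M i j ^ 2 ∧ 1 / 2 < T i (σ i) ^ 2)}.Finite := by
    have e1 := hvs.tendsto_cofinite_zero.eventually_lt_const (show (0 : ℝ) < 1 / 4096 by norm_num)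
    have e2 := hS.tendsto_cofinite_zero.eventually_lt_const (show (0 : ℝ) < 1 by norm_num)
    refine (e1.and e2).mono fun i hi => ?_
    have hd : 1 - 1 / 4096 ≤ ∑' j, M i j ^ 2 := by linarith [hvM i, hi.1]
    refine ⟨hd, ?_⟩
    by_contra! hle
    have := hi.2
    rw [if_pos ⟨hd, hle⟩] at this
    exact lt_irrefl _ this
  have hB : ∀ i, i ∉ hfin.toFinset → 1 - 1 / 4096 ≤ ∑' j, M i j ^ 2 ∧ 1 / 2 < T i (σ i) ^ 2 := by
    intro i hi
    by_contra hc
    exact hi (hfin.mem_toFinset.2 hc)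
  have hinj : InjOn σ {i | i ∉ hfin.toFinset} := by
    intro i hi k hk hik
    by_contra hne
    have h1 := (hP.col (σ i)).summable.sum_le_tsum {i, k} fun _ _ => sq_nonneg _
    rw [(hP.col (σ i)).tsum_eq, Finset.sum_pair hne] at h1
    have h2 := (hB i hi).2
    have h3 := (hB k hk).2
    rw [← hik] at h3
    linarith
  have hsumr : ∀ Z : Finset ℕ, (∀ i ∈ Z, i ∉ hfin.toFinset) →
      ∑ i ∈ Z, rest (M i) (σ i) ≤ 32 * L + 16 := by
    intro Z hZ
    have h1 := h.sum_rest_le (Z.filter fun i => 1 - √(rest (M i) (σ i)) / 16 ≤ |M i (σ i)|) σ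
      (hinj.mono fun i hi => hZ i (Finset.mem_filter.1 hi).1) fun i hi =>
        ⟨hσ3 i (hB i (hZ i (Finset.mem_filter.1 hi).1)).1, (Finset.mem_filter.1 hi).2⟩
    rw [Finset.sum_filter] at h1
    have h2 : ∀ i ∈ Z, rest (M i) (σ i) ≤ 32 * (1 - v i) +
        if 1 - √(rest (M i) (σ i)) / 16 ≤ |M i (σ i)| then √(rest (M i) (σ i)) else 0 := by
      intro i hi
      have h3 := hσ3 i (hB i (hZ i hi)).1
      have h4 := hr i
      have h5 := hrsq i
      have h6 := hv1 i
      have h7 := hvM i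
      rw [tsum_sq_eq_sq_add_rest (hM i) (σ i), ← sq_abs] at h7
      have h9 := abs_nonneg (M i (σ i))
      split_ifs with hc
      · nlinarith
      · push Not at hc
        have h8 : |M i (σ i)| ^ 2 ≤ (1 - √(rest (M i) (σ i)) / 16) ^ 2 :=
          pow_le_pow_left₀ h9 hc.le 2
        nlinarith
    refine (Finset.sum_le_sum h2).trans ?_
    rw [Finset.sum_add_distrib, ← Finset.mul_sum]
    have := hP.sum_loss_le Z
    have e : ∑ i ∈ Z, (1 - v i) ≤ L := this
    linarith
  refine ⟨hfin.toFinset, σ, hinj, fun i hi => ⟨(hB i hi).2, ?_⟩, ?_, ?_⟩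
  · have := hσ1 i (hB i hi).1
    change 1 / 4 ≤ M i (σ i) ^ 2
    rw [← sq_abs]
    nlinarith
  · refine summable_ite_of_sum_le (C := (L + Real.exp 4 * (32 * L + 16)) / 4)
      (fun i _ => sub_nonneg.2 (hP.entry_le i _)) fun Z hZ => ?_
    have h1 := hent Z
    have h2 := hsumr Z hZ
    have h3 : ∑ i ∈ Z, Real.exp 4 * ((∑' j, T i j ^ 2 * s j - T i (σ i) ^ 2 * s (σ i)) / a i ^ 2)
        ≤ Real.exp 4 * (32 * L + 16) := by
      rw [← Finset.mul_sum]
      exact mul_le_mul_of_nonneg_left ((Finset.sum_le_sum fun i _ => hw i).trans h2)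
        (Real.exp_pos _).le
    rw [Finset.sum_sub_distrib, ← Finset.mul_sum] at h1
    linarith
  · exact summable_ite_of_sum_le (fun i _ => rest_nonneg _ _) hsumr

lemma one_sub_sum_le_prod {ι : Type*} (s : Finset ι) {x : ι → ℝ} (hx : ∀ i, 0 ≤ x i ∧ x i ≤ 1) :
    1 - ∑ i ∈ s, (1 - x i) ≤ ∏ i ∈ s, x i := by
  classical
  induction s using Finset.induction_on with
  | empty => simp
  | insert i s hi ih =>
    rw [Finset.sum_insert hi, Finset.prod_insert hi]
    have h1 : ∏ i ∈ s, x i ≤ 1 := Finset.prod_le_one (fun i _ => (hx i).1) fun i _ => (hx i).2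
    nlinarith [hx i]

/-- A contraction which almost preserves the lengths of the unit vectors has determinant almost
one. -/
lemma one_sub_le_det_sq {n : Type*} [Fintype n] [DecidableEq n] (N : Matrix n n ℝ)
    (hN : ∀ x : n → ℝ, ∑ i, (N.mulVec x i) ^ 2 ≤ ∑ i, x i ^ 2) :
    1 - ∑ k, (1 - ∑ i, N i k ^ 2) ≤ N.det ^ 2 := by
  have hG := Matrix.posSemidef_conjTranspose_mul_self N
  have h1 : ∀ i, 0 ≤ hG.isHermitian.eigenvalues i ∧ hG.isHermitian.eigenvalues i ≤ 1 := fun i => by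
    refine ⟨hG.eigenvalues_nonneg i, ?_⟩
    rw [hG.isHermitian.eigenvalues_eq]
    set w : n → ℝ := ⇑(hG.isHermitian.eigenvectorBasis i)
    have hw : ∑ k, w k ^ 2 = 1 := by
      have := hG.isHermitian.eigenvectorBasis.orthonormal.1 i
      rw [EuclideanSpace.norm_eq, Real.sqrt_eq_one] at this
      simpa only [Real.norm_eq_abs, sq_abs] using this
    have h2 : RCLike.re (star w ⬝ᵥ ((N.conjTranspose * N).mulVec w)) = ∑ k, (N.mulVec w k) ^ 2 := by
      simp only [star_trivial, RCLike.re_to_real]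
      rw [← Matrix.mulVec_mulVec, Matrix.dotProduct_mulVec,
        Matrix.conjTranspose_eq_transpose_of_trivial,
        Matrix.vecMul_transpose, dotProduct]
      simp only [sq]
    rw [h2]
    exact (hN w).trans_eq hw
  have h2 := one_sub_sum_le_prod Finset.univ h1
  have h3 : ∏ i, hG.isHermitian.eigenvalues i = N.det ^ 2 := by
    have e : (N.conjTranspose * N).det = N.det ^ 2 := by
      rw [Matrix.det_mul, Matrix.conjTranspose_eq_transpose_of_trivial, Matrix.det_transpose, sq]
    exact Eq.trans (Eq.symm hG.isHermitian.det_eq_prod_eigenvalues) e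
  have h4 : ∑ i, hG.isHermitian.eigenvalues i = ∑ k, ∑ i, N i k ^ 2 := by
    have := hG.isHermitian.trace_eq_sum_eigenvalues
    rw [Matrix.trace] at this
    refine Eq.trans (Eq.symm this) (Finset.sum_congr rfl fun k _ => ?_)
    simp [Matrix.mul_apply, sq]
  rw [Finset.sum_sub_distrib, h4, h3] at h2
  rwa [Finset.sum_sub_distrib]

/-- Submatrices of a matrix with orthonormal columns are contractions. -/
lemma sum_sq_submatrix_le {T : ℕ → ℕ → ℝ}
    (hT : ∀ j k, HasSum (fun i => T i j * T i k) (if j = k then 1 else 0)) {ι κ : Type*} [Fintype ι]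
    [Fintype κ] (r : ι → ℕ) (hr : Function.Injective r) (c : κ → ℕ) (hc : Function.Injective c)
    (x : κ → ℝ) : ∑ i, (∑ k, T (r i) (c k) * x k) ^ 2 ≤ ∑ k, x k ^ 2 := by
  classical
  have h : HasSum (fun i => (∑ k, T i (c k) * x k) ^ 2) (∑ k, x k ^ 2) := by
    have h1 : HasSum (fun i => ∑ k, ∑ l, T i (c k) * T i (c l) * (x k * x l))
        (∑ k, ∑ l, (if c k = c l then 1 else 0) * (x k * x l)) :=
      hasSum_sum fun k _ => hasSum_sum fun l _ => (hT (c k) (c l)).mul_right _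
    convert h1 using 1
    · ext i
      rw [sq, Finset.sum_mul_sum]
      exact Finset.sum_congr rfl fun k _ => Finset.sum_congr rfl fun l _ => by ring
    · refine Finset.sum_congr rfl fun k _ => ?_
      simp [hc.eq_iff, sq]
  have := sum_le_hasSum (Finset.univ.image r) (fun i _ => sq_nonneg _) h
  rwa [Finset.sum_image fun i _ j _ hij => hr hij] at this

lemma prod_le_prod_of_threshold {a : ℕ → ℝ} (ha : ∀ i, 0 < a i) {τ : ℝ} (hτ : 0 < τ)
    {I S : Finset ℕ} (hcard : I.card = S.card) (hS : ∀ j, j ∈ S ↔ τ ≤ a j) :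
    ∏ i ∈ I, a i ≤ ∏ j ∈ S, a j := by
  rw [← Finset.prod_sdiff (Finset.inter_subset_left (s₁ := I) (s₂ := S)),
    ← Finset.prod_sdiff (Finset.inter_subset_right (s₁ := I) (s₂ := S)),
    Finset.sdiff_inter_self_left, Finset.sdiff_inter_self_right]
  refine mul_le_mul_of_nonneg_right ?_ (Finset.prod_nonneg fun i _ => (ha i).le)
  calc ∏ i ∈ I \ S, a i ≤ ∏ _i ∈ I \ S, τ := Finset.prod_le_prod (fun i _ => (ha i).le)
        fun i hi => by
          have := (Finset.mem_sdiff.1 hi).2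
          rw [hS] at this
          linarith
    _ = ∏ _i ∈ S \ I, τ := by
          rw [Finset.prod_const, Finset.prod_const, Finset.card_sdiff_comm hcard]
    _ ≤ ∏ i ∈ S \ I, a i := Finset.prod_le_prod (fun _ _ => hτ.le)
        fun i hi => (hS i).1 (Finset.mem_sdiff.1 hi).1

lemma exists_pos_le_on {a : ℕ → ℝ} (ha : ∀ i, 0 < a i) (J : Finset ℕ) :
    ∃ τ > 0, ∀ j ∈ J, τ ≤ a j := by
  rcases J.eq_empty_or_nonempty with rfl | hJ
  · exact ⟨1, one_pos, by simp⟩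
  · obtain ⟨k, -, hk⟩ := J.exists_min_image a hJ
    exact ⟨a k, ha k, hk⟩

/-- Finite index sets carrying almost all of the mass of the corresponding columns. -/
lemma exists_index_sets {T : ℕ → ℕ → ℝ} {a ℓ : ℕ → ℝ} (ha0 : ∀ i, 0 < a i)
    (ha : Summable fun i => a i ^ 2) (hcol : ∀ j, HasSum (fun i => T i j ^ 2) 1)
    (hrow : ∀ i, HasSum (fun j => T i j ^ 2) 1) (hℓ : ∀ j, ℓ j ≤ 1) {ℓ₀ : ℝ} (h0 : 0 < ℓ₀)
    (hℓ₀ : ∀ j, ℓ₀ ≤ ℓ j) {B₀ : Finset ℕ} {σ : ℕ → ℕ} (hinj : InjOn σ {i | i ∉ B₀})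
    (hσ : ∀ i, i ∉ B₀ → 1 / 4 ≤ (T i (σ i) * (a (σ i) * ℓ (σ i)) / a i) ^ 2)
    (hs1 : Summable fun i => if i ∉ B₀ then 1 - T i (σ i) ^ 2 else 0)
    (hs2 : Summable fun i => if i ∉ B₀ then rest (fun j => T i j * (a j * ℓ j) / a i) (σ i) else 0)
    (W : Finset ℕ) {δ : ℝ} (hδ : 0 < δ) (hδ1 : δ < 1) :
    ∃ I S : Finset ℕ, W ⊆ I ∧ I.card = S.card ∧ ∏ i ∈ I, a i ≤ ∏ j ∈ S, a j ∧
      ∑ j ∈ S, (1 - ∑ i ∈ I, T i j ^ 2) ≤ δ := by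
  classical
  set η : ℝ := δ * ℓ₀ ^ 2 / 4 with hη
  obtain ⟨B₁, hB₁⟩ := summable_iff_vanishing_norm.1 hs1 (1 / 4) (by norm_num)
  obtain ⟨B₂, hB₂⟩ := summable_iff_vanishing_norm.1 hs2 η (by positivity)
  set B := B₀ ∪ W ∪ B₁ ∪ B₂ with hBdef
  have hBB₀ : ∀ i, i ∉ B → i ∉ B₀ := fun i hi h => hi (by simp [hBdef, h])
  have ht1 : ∀ Z : Finset ℕ, Disjoint Z B → ∑ i ∈ Z, (1 - T i (σ i) ^ 2) ≤ 1 / 4 := by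
    intro Z hZ
    have h1 := (le_abs_self _).trans (hB₁ Z (hZ.mono_right (by intro x; simp [hBdef]; tauto))).le
    refine le_trans (Finset.sum_le_sum fun i hi => ?_) h1
    rw [if_pos (hBB₀ i (Finset.disjoint_left.1 hZ hi))]
  have ht2 : ∀ Z : Finset ℕ, Disjoint Z B →
      ∑ i ∈ Z, rest (fun j => T i j * (a j * ℓ j) / a i) (σ i) ≤ η := by
    intro Z hZ
    have h1 := (le_abs_self _).trans (hB₂ Z (hZ.mono_right (by intro x; simp [hBdef]; tauto))).le
    refine le_trans (Finset.sum_le_sum fun i hi => ?_) h1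
    rw [if_pos (hBB₀ i (Finset.disjoint_left.1 hZ hi))]
  have hF : ∀ i, ∃ F : Finset ℕ, ∀ F', F ⊆ F' →
      1 - 1 / (8 * ((B.card : ℝ) + 1)) < ∑ j ∈ F', T i j ^ 2 := fun i => by
    have hlt : 1 - 1 / (8 * ((B.card : ℝ) + 1)) < 1 := by
      have : 0 < 1 / (8 * ((B.card : ℝ) + 1)) := by positivity
      linarith
    exact eventually_atTop.1 ((hrow i).eventually_const_lt hlt)
  choose F hF using hF
  obtain ⟨τ, hτ, hτJ⟩ := exists_pos_le_on ha0 (B.biUnion F)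
  have hfinS : {j | τ ≤ a j}.Finite := by
    have := ha.tendsto_cofinite_zero.eventually_lt_const (show (0 : ℝ) < τ ^ 2 by positivity)
    refine (eventually_cofinite.1 this).subset fun j hj => not_lt.2 ?_
    exact pow_le_pow_left₀ hτ.le hj 2
  set S := hfinS.toFinset with hSdef
  have hS : ∀ j, j ∈ S ↔ τ ≤ a j := fun j => hfinS.mem_toFinset
  have hfinI : {i | i ∉ B ∧ σ i ∈ S}.Finite :=
    Finite.of_injOn (fun i hi => hi.2) (hinj.mono fun i hi => hBB₀ i hi.1) S.finite_toSet
  set I := B ∪ hfinI.toFinset with hI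
  have hmemI : ∀ i, i ∈ I ↔ i ∈ B ∨ (i ∉ B ∧ σ i ∈ S) := fun i => by
    simp [hI]
  have hlow : (I.card : ℝ) - 1 / 2 ≤ ∑ i ∈ I, ∑ j ∈ S, T i j ^ 2 := by
    have hdis : Disjoint B hfinI.toFinset := by
      rw [Finset.disjoint_right]; intro i hi; exact (hfinI.mem_toFinset.1 hi).1
    have h1 : ∑ i ∈ B, (1 - ∑ j ∈ S, T i j ^ 2) ≤ 1 / 4 := by
      have : ∀ i ∈ B, 1 - ∑ j ∈ S, T i j ^ 2 ≤ 1 / (8 * ((B.card : ℝ) + 1)) := fun i hi => by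
        have := hF i S fun j hj => (hS j).2 (hτJ j (Finset.mem_biUnion.2 ⟨i, hi, hj⟩))
        linarith
      refine (Finset.sum_le_card_nsmul _ _ _ this).trans ?_
      rw [nsmul_eq_mul, mul_one_div, div_le_iff₀ (by positivity)]
      have : (0 : ℝ) ≤ B.card := by positivity
      linarith
    have h2 : ∑ i ∈ hfinI.toFinset, (1 - ∑ j ∈ S, T i j ^ 2) ≤ 1 / 4 := by
      refine le_trans (Finset.sum_le_sum fun i hi => ?_) (ht1 _ hdis.symm)
      have := Finset.single_le_sum (f := fun j => T i j ^ 2) (fun _ _ => sq_nonneg _)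
        (hfinI.mem_toFinset.1 hi).2
      linarith
    have h3 : ∑ i ∈ I, (1 - ∑ j ∈ S, T i j ^ 2) ≤ 1 / 2 := by
      rw [hI, Finset.sum_union hdis]; linarith
    rw [Finset.sum_sub_distrib, Finset.sum_const, nsmul_one] at h3
    linarith
  have hup : ∑ j ∈ S, (1 - ∑ i ∈ I, T i j ^ 2) ≤ δ := by
    have h1 : HasSum (fun i => ∑ j ∈ S, T i j ^ 2) (∑ _j ∈ S, 1) := hasSum_sum fun j _ => hcol j
    have h2 : ∀ i, i ∉ I → ∑ j ∈ S, T i j ^ 2 ≤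
        4 / ℓ₀ ^ 2 * rest (fun j => T i j * (a j * ℓ j) / a i) (σ i) := by
      intro i hi
      have hiB : i ∉ B := fun h => hi ((hmemI i).2 (Or.inl h))
      have hiS : σ i ∉ S := fun h => hi ((hmemI i).2 (Or.inr ⟨hiB, h⟩))
      have haσ : a (σ i) < τ := by rwa [hS, not_le] at hiS
      have hT1 : ∀ j, T i j ^ 2 ≤ 1 := fun j => le_hasSum (hcol j) i fun _ _ => sq_nonneg _
      have hai : a i ^ 2 ≤ 4 * τ ^ 2 := by
        have h := hσ i (hBB₀ i hiB)
        rw [div_pow, le_div_iff₀ (by have := ha0 i; positivity), mul_pow] at h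
        have h5 : (a (σ i) * ℓ (σ i)) ^ 2 ≤ τ ^ 2 := by
          have h6 := h0.trans_le (hℓ₀ (σ i))
          have h7 := ha0 (σ i)
          refine pow_le_pow_left₀ (by positivity) ?_ 2
          nlinarith [hℓ (σ i)]
        nlinarith [hT1 (σ i), sq_nonneg (T i (σ i)), sq_nonneg (a (σ i) * ℓ (σ i))]
      have hsum : Summable fun j =>
          Function.update (fun j => T i j * (a j * ℓ j) / a i) (σ i) 0 j ^ 2
          := by
        refine Summable.of_nonneg_of_le (fun _ => sq_nonneg _) (fun j => ?_)
          ((ha.mul_right (1 / a i ^ 2)))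
        by_cases hj : j = σ i
        · subst hj; simp; positivity
        · simp only [Function.update_of_ne hj]
          have h6 := h0.trans_le (hℓ₀ j)
          have : T i j ^ 2 * ℓ j ^ 2 ≤ 1 := mul_le_one₀ (hT1 j) (sq_nonneg _)
            (pow_le_one₀ h6.le (hℓ j))
          calc (T i j * (a j * ℓ j) / a i) ^ 2 =
              a j ^ 2 * (1 / a i ^ 2) * (T i j ^ 2 * ℓ j ^ 2) := by
                ring
            _ ≤ _ := mul_le_of_le_one_right (by positivity) this
      rw [rest]
      have h8 := hsum.sum_le_tsum S fun _ _ => sq_nonneg _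
      refine le_trans ?_ (mul_le_mul_of_nonneg_left h8 (by positivity))
      rw [Finset.mul_sum]
      refine Finset.sum_le_sum fun j hj => ?_
      have hjσ : j ≠ σ i := fun h => hiS (h ▸ hj)
      rw [Function.update_of_ne hjσ]
      have haj := (hS j).1 hj
      have h9 : a i ^ 2 * ℓ₀ ^ 2 ≤ 4 * (a j * ℓ j) ^ 2 := by
        have e1 : τ ^ 2 ≤ a j ^ 2 := pow_le_pow_left₀ hτ.le haj 2
        have e2 : ℓ₀ ^ 2 ≤ ℓ j ^ 2 := pow_le_pow_left₀ h0.le (hℓ₀ j) 2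
        calc a i ^ 2 * ℓ₀ ^ 2 ≤ (4 * a j ^ 2) * ℓ j ^ 2 :=
              mul_le_mul (by linarith) e2 (by positivity) (by positivity)
          _ = _ := by ring
      have := ha0 i
      calc T i j ^ 2 = T i j ^ 2 * (a i ^ 2 * ℓ₀ ^ 2) / (a i ^ 2 * ℓ₀ ^ 2) := by field_simp
        _ ≤ T i j ^ 2 * (4 * (a j * ℓ j) ^ 2) / (a i ^ 2 * ℓ₀ ^ 2) := by gcongr
        _ = _ := by field_simp
    have h3 : ∀ Z : Finset ℕ, ∑ i ∈ Z, ∑ j ∈ S, T i j ^ 2 ≤ ∑ i ∈ I, ∑ j ∈ S, T i j ^ 2 + δ := by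
      intro Z
      have hZ : ∑ i ∈ Z \ I, ∑ j ∈ S, T i j ^ 2 ≤ δ := by
        refine (Finset.sum_le_sum fun i hi => h2 i (Finset.mem_sdiff.1 hi).2).trans ?_
        rw [← Finset.mul_sum]
        have hd : Disjoint (Z \ I) B := by
          rw [Finset.disjoint_left]
          exact fun i hi hB => (Finset.mem_sdiff.1 hi).2 ((hmemI i).2 (Or.inl hB))
        refine (mul_le_mul_of_nonneg_left (ht2 _ hd) (by positivity)).trans_eq ?_
        rw [hη]; field_simp
      have hsub : ∑ i ∈ Z, ∑ j ∈ S, T i j ^ 2 ≤ ∑ i ∈ I ∪ Z \ I, ∑ j ∈ S, T i j ^ 2 := by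
        refine Finset.sum_le_sum_of_subset_of_nonneg (fun i hi => ?_) fun i _ _ =>
          Finset.sum_nonneg fun _ _ => sq_nonneg _
        simp only [Finset.mem_union, Finset.mem_sdiff]; tauto
      rw [Finset.sum_union Finset.disjoint_sdiff] at hsub
      linarith
    have h4 := hasSum_le_of_sum_le h1 h3
    rw [Finset.sum_sub_distrib, Finset.sum_comm]
    linarith
  have hcard : I.card = S.card := by
    have h1 : ∑ i ∈ I, ∑ j ∈ S, T i j ^ 2 ≤ S.card := by
      rw [Finset.sum_comm]
      refine (Finset.sum_le_card_nsmul _ _ 1 fun j _ => ?_).trans_eq (by simp)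
      exact sum_le_hasSum I (fun _ _ => sq_nonneg _) (hcol j)
    have h2 : ∑ i ∈ I, ∑ j ∈ S, T i j ^ 2 ≤ I.card := by
      refine (Finset.sum_le_card_nsmul _ _ 1 fun i _ => ?_).trans_eq (by simp)
      exact sum_le_hasSum S (fun _ _ => sq_nonneg _) (hrow i)
    rw [Finset.sum_sub_distrib, Finset.sum_comm, Finset.sum_const, nsmul_one] at hup
    have h3 : (I.card : ℝ) < S.card + 1 := by linarith
    have h4 : (S.card : ℝ) < I.card + 1 := by linarith
    have h5 : I.card < S.card + 1 := by exact_mod_cast h3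
    have h6 : S.card < I.card + 1 := by exact_mod_cast h4
    omega
  exact ⟨I, S, fun w hw => (hmemI w).2 (Or.inl (by simp [hBdef, hw])), hcard,
    prod_le_prod_of_threshold ha0 hτ hcard hS, hup⟩

/-- Large finite minors of the matrix of an isometry are almost volume preserving. -/
lemma exists_matrix_minors {a : ℕ → ℝ} (ha0 : ∀ i, 0 < a i) (ha : Summable fun i => a i ^ 2)
    {K : Set Q} (hK : IsCompact K) (h0 : mu K ≠ 0) (f : Q → Q)
    (hf : ∀ x ∈ K, ∀ y ∈ K, ∑' i, a i ^ 2 * ((f x i : ℝ) - f y i) ^ 2 =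
      ∑' i, a i ^ 2 * ((x i : ℝ) - y i) ^ 2) :
    ∃ T : ℕ → ℕ → ℝ, (∀ i, Summable fun j => T i j ^ 2) ∧
      (∀ x ∈ K, ∀ y ∈ K, ∀ i,
        HasSum (fun j => T i j * (a j * ((x j : ℝ) - y j))) (a i * ((f x i : ℝ) - f y i))) ∧
      ∀ (W : Finset ℕ) (δ : ℝ), 0 < δ → δ < 1 → ∃ (I S : Finset ℕ) (e : I ≃ S), W ⊆ I ∧
        ∏ i ∈ I, a i ≤ ∏ j ∈ S, a j ∧
        1 - δ ≤ (Matrix.of fun i k : I => T i (e k)).det ^ 2 := by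
  obtain ⟨T, hT, hrow, haff, ℓ, hℓ, ⟨ℓ₀, hℓ₀, hℓℓ₀⟩, hn, hM⟩ :=
    exists_structured_matrix ha0 ha hK h0 f hf
  have hcol : ∀ j, HasSum (fun i => T i j ^ 2) 1 := fun j => by
    simpa [sq] using hT j j
  obtain ⟨s, L, hP, hsb⟩ := exists_comparison ha0 ha hcol hrow hℓ hn hM
  have hrow1 : ∀ i, HasSum (fun j => T i j ^ 2) 1 := fun i => by
    have := hP.row_eq_one i
    exact this ▸ (hrow i).1.hasSum
  have hb : Summable fun j => (a j * ℓ j) ^ 2 := ha.of_nonneg_of_le (fun _ => sq_nonneg _)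
    fun j => by
      rw [mul_pow]
      exact mul_le_of_le_one_right (sq_nonneg _) (pow_le_one₀ (hℓ j).1.le (hℓ j).2)
  obtain ⟨B, σ, hinj, hσ, hs1, hs2⟩ := exists_concentration ha0 hb hP hsb hM
  refine ⟨T, fun i => (hrow i).1, haff, fun W δ hδ hδ1 => ?_⟩
  obtain ⟨I, S, hW, hcard, hprod, hmass⟩ := exists_index_sets ha0 ha hcol hrow1
    (fun j => (hℓ j).2) hℓ₀ hℓℓ₀ hinj (fun i hi => (hσ i hi).2) hs1 hs2 W hδ hδ1
  let e : I ≃ S := Finset.equivOfCardEq hcard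
  refine ⟨I, S, e, hW, hprod, ?_⟩
  refine le_trans ?_ (one_sub_le_det_sq _ fun x => ?_)
  · have e1 : ∑ k : I, (1 - ∑ i : I, T i (e k) ^ 2) = ∑ j ∈ S, (1 - ∑ i ∈ I, T i j ^ 2) := by
      rw [e.sum_comp (fun j : S => 1 - ∑ i : I, T i j ^ 2),
        Finset.sum_coe_sort S fun j => 1 - ∑ i : I, T i j ^ 2]
      refine Finset.sum_congr rfl fun j _ => ?_
      rw [Finset.sum_coe_sort I fun i => T i j ^ 2]
    simp only [Matrix.of_apply]
    linarith
  · exact sum_sq_submatrix_le hT (fun i : I => (i : ℕ)) Subtype.val_injective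
      (fun k : I => ((e k : S) : ℕ)) (Subtype.val_injective.comp e.injective) x

/-- Real coordinates along an index map. -/
def coords {ι : Type*} (r : ι → ℕ) (u : Q) (i : ι) : ℝ := u (r i)

lemma continuous_coords {ι : Type*} (r : ι → ℕ) : Continuous (coords r) := by
  unfold coords; fun_prop

lemma coords_mem {ι : Type*} (r : ι → ℕ) (u : Q) : coords r u ∈ pi univ fun _ => Icc (0 : ℝ) 1 :=
  fun i _ => (u (r i)).2

lemma measurePreserving_coords {ι : Type*} [Fintype ι] {r : ι → ℕ} (hr : Function.Injective r) :
    MeasurePreserving (coords r) mu (volume.restrict (pi univ fun _ => Icc (0 : ℝ) 1)) := by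
  classical
  refine ⟨(continuous_coords r).measurable, ?_⟩
  rw [volume_pi, Measure.restrict_pi_pi]
  refine (Measure.pi_eq fun s hs => ?_).symm
  rw [Measure.map_apply (continuous_coords r).measurable (MeasurableSet.univ_pi hs)]
  let t : ℕ → Set unitInterval := fun n => {x | ∀ i, r i = n → (x : ℝ) ∈ s i}
  have hti : ∀ i, t (r i) = (fun x : unitInterval => (x : ℝ)) ⁻¹' s i := fun i => by
    ext x
    exact ⟨fun h => h i rfl, fun h k hk => hr hk ▸ h⟩
  have e : coords r ⁻¹' pi univ s = Set.pi (Finset.univ.image r : Finset ℕ) t := by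
    ext u
    simp only [mem_preimage, Set.mem_pi, mem_univ, true_imp_iff, Finset.mem_coe, Finset.mem_image,
      Finset.mem_univ, true_and, forall_exists_index, forall_apply_eq_imp_iff]
    exact forall_congr' fun i => by rw [hti, coords, mem_preimage]
  rw [e, mu, Measure.infinitePi_pi _ fun n hn => ?_]
  · rw [Finset.prod_image fun i _ k _ hik => hr hik]
    refine Finset.prod_congr rfl fun i _ => ?_
    rw [hti, unitInterval.volume_apply, Measure.restrict_apply (hs i)]
    congr 1
    ext x
    simp [and_comm]
  · obtain ⟨i, -, rfl⟩ := Finset.mem_image.1 hn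
    rw [hti]
    exact measurable_subtype_coe (hs i)

/-- The volume of a compact set of coordinates is the measure of the cylinder over it. -/
lemma mu_preimage_coords {ι : Type*} [Fintype ι] {r : ι → ℕ} (hr : Function.Injective r)
    {A : Set Q} (hA : IsCompact A) :
    mu (coords r ⁻¹' (coords r '' A)) = volume (coords r '' A) := by
  have hm := (hA.image (continuous_coords r)).measurableSet
  rw [(measurePreserving_coords hr).measure_preimage hm.nullMeasurableSet,
    Measure.restrict_apply hm, inter_eq_left.2]
  rintro _ ⟨u, -, rfl⟩
  exact coords_mem r u

lemma det_rescale {ι : Type*} [Fintype ι] [DecidableEq ι] (N : Matrix ι ι ℝ) (b c : ι → ℝ) :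
    (Matrix.of fun i k => N i k * b k / c i).det = N.det * (∏ k, b k) / ∏ i, c i := by
  have : (Matrix.of fun i k => N i k * b k / c i) =
      Matrix.diagonal (fun i => (c i)⁻¹) * N * Matrix.diagonal b := by
    ext i k
    rw [Matrix.mul_diagonal, Matrix.diagonal_mul, Matrix.of_apply]
    ring
  rw [this, Matrix.det_mul, Matrix.det_mul, Matrix.det_diagonal, Matrix.det_diagonal,
    Finset.prod_inv_distrib]
  ring

/-- A slice of `K` at least as large as `K`. -/
lemma exists_large_slice {K : Set Q} (hK : MeasurableSet K) (S : Set ℕ)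
    [DecidablePred (· ∈ S)] : ∃ z : Q, mu K ≤ mu {u | S.piecewise u z ∈ K} := by
  have h := measurePreserving_piecewise S
  have hm := h.measurable hK
  have e := h.measure_preimage hK.nullMeasurableSet
  rw [Measure.prod_apply_symm hm] at e
  obtain ⟨z, hz⟩ := exists_lintegral_le (μ := mu) (e.trans_ne (measure_ne_top mu K))
  exact ⟨z, e.symm.trans_le hz⟩

/-- An affine map multiplies the volume of a slice by the determinant of the matrix. -/
lemma det_mul_measure_le {T : ℕ → ℕ → ℝ} {a : ℕ → ℝ} (ha0 : ∀ i, 0 < a i) {K : Set Q}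
    (hK : IsCompact K) {f : Q → Q} (hfK : IsCompact (f '' K)) (h0 : mu K ≠ 0)
    (haff : ∀ x ∈ K, ∀ y ∈ K, ∀ i,
      HasSum (fun j => T i j * (a j * ((x j : ℝ) - y j))) (a i * ((f x i : ℝ) - f y i)))
    {I S : Finset ℕ} (e : I ≃ S) :
    ENNReal.ofReal |(Matrix.of fun i k : I => T i (e k) * a (e k) / a i).det| * mu K ≤
      mu (coords (fun i : I => (i : ℕ)) ⁻¹' (coords (fun i : I => (i : ℕ)) '' (f '' K))) := by
  classical
  set r : I → ℕ := fun i => i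
  set c : I → ℕ := fun k => e k
  have hr : Function.Injective r := Subtype.val_injective
  have hc : Function.Injective c := Subtype.val_injective.comp e.injective
  set N := Matrix.of fun i k : I => T i (e k) * a (e k) / a i with hN
  obtain ⟨z, hz⟩ := exists_large_slice hK.measurableSet (S : Set ℕ)
  set Lz : Set Q := {u | (S : Set ℕ).piecewise u z ∈ K} with hLz
  have hcont : Continuous fun u : Q => (S : Set ℕ).piecewise u z := by
    refine continuous_pi fun i => ?_
    by_cases hi : i ∈ (S : Set ℕ)
    · simp only [Set.piecewise, hi, if_true]; fun_prop
    · simp only [Set.piecewise, hi, if_false]; fun_prop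
  have hLc : IsCompact Lz := (hK.isClosed.preimage hcont).isCompact
  obtain ⟨u₀, hu₀⟩ : Lz.Nonempty := by
    refine nonempty_of_measure_ne_zero (μ := mu) fun h => h0 ?_
    exact le_antisymm (hz.trans_eq h) zero_le
  rw [mu_preimage_coords hr hfK]
  have h1 : mu K ≤ volume (coords c '' Lz) := by
    rw [← mu_preimage_coords hc hLc]
    exact hz.trans (measure_mono (subset_preimage_image _ _))
  have h2 : ∀ u ∈ Lz, N.mulVec (coords c u) = coords r (f ((S : Set ℕ).piecewise u z)) +
      (N.mulVec (coords c u₀) - coords r (f ((S : Set ℕ).piecewise u₀ z))) := by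
    intro u hu
    ext i
    have h3 := haff _ hu _ hu₀ i
    have h4 : HasSum (fun j => T i j * (a j * (((S : Set ℕ).piecewise u z j : ℝ) -
        (S : Set ℕ).piecewise u₀ z j))) (∑ j ∈ S, T i j * (a j *
          (((S : Set ℕ).piecewise u z j : ℝ) - (S : Set ℕ).piecewise u₀ z j))) :=
      hasSum_sum_of_ne_finset_zero fun j hj => by
        rw [piecewise_eq_of_notMem _ _ _ (by simpa using hj),
          piecewise_eq_of_notMem _ _ _ (by simpa using hj)]
        simp
    have h5 := h3.unique h4
    have h6 : ∑ j ∈ S, T i j * (a j * (((S : Set ℕ).piecewise u z j : ℝ) -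
        (S : Set ℕ).piecewise u₀ z j)) = ∑ k : I, T i (c k) * (a (c k) *
          ((u (c k) : ℝ) - u₀ (c k))) := by
      rw [← Finset.sum_coe_sort, ← e.sum_comp]
      refine Finset.sum_congr rfl fun k _ => ?_
      rw [piecewise_eq_of_mem _ _ _ (by simp), piecewise_eq_of_mem _ _ _ (by simp)]
    have h7 : N.mulVec (coords c u) i - N.mulVec (coords c u₀) i =
        (∑ k : I, T i (c k) * (a (c k) * ((u (c k) : ℝ) - u₀ (c k)))) / a i := by
      simp only [Matrix.mulVec, dotProduct, hN, Matrix.of_apply, coords]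
      rw [← Finset.sum_sub_distrib, Finset.sum_div]
      exact Finset.sum_congr rfl fun k _ => by ring
    rw [← h6, ← h5, mul_div_cancel_left₀ _ (ha0 i).ne'] at h7
    simp only [Pi.add_apply, Pi.sub_apply, coords] at h7 ⊢
    linarith
  set v := N.mulVec (coords c u₀) - coords r (f ((S : Set ℕ).piecewise u₀ z))
  calc ENNReal.ofReal |N.det| * mu K ≤ ENNReal.ofReal |N.det| * volume (coords c '' Lz) := by gcongr
    _ = volume (Matrix.toLin' N '' (coords c '' Lz)) := by
      rw [Measure.addHaar_image_linearMap, LinearMap.det_toLin']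
    _ ≤ volume ((fun y => y + v) '' (coords r '' (f '' K))) := by
      refine measure_mono ?_
      rintro _ ⟨_, ⟨u, hu, rfl⟩, rfl⟩
      exact ⟨_, ⟨_, ⟨_, hu, rfl⟩, rfl⟩, (h2 u hu).symm⟩
    _ = volume (coords r '' (f '' K)) := by
      rw [image_add_right, measure_preimage_add_right]

/-- A closed set is the limit of the cylinders over its projections. -/
lemma tendsto_mu_cylinder {A : Set Q} (hA : IsCompact A) :
    Tendsto (fun n => mu (coords (fun i : Finset.range n => (i : ℕ)) ⁻¹'
      (coords (fun i : Finset.range n => (i : ℕ)) '' A))) atTop (𝓝 (mu A)) := by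
  set C : ℕ → Set Q := fun n => coords (fun i : Finset.range n => (i : ℕ)) ⁻¹'
      (coords (fun i : Finset.range n => (i : ℕ)) '' A) with hC
  have hmem : ∀ n y, y ∈ C n ↔ ∃ x ∈ A, ∀ i < n, x i = y i := fun n y => by
    simp only [hC, mem_preimage, mem_image]
    refine exists_congr fun x => and_congr_right fun _ => ?_
    constructor
    · intro h i hi
      exact Subtype.ext (congrFun h ⟨i, Finset.mem_range.2 hi⟩)
    · intro h
      ext i
      rw [coords, coords, h i (Finset.mem_range.1 i.2)]
  have hanti : Antitone C := fun m n hmn y hy => by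
    obtain ⟨x, hx, h⟩ := (hmem n y).1 hy
    exact (hmem m y).2 ⟨x, hx, fun i hi => h i (hi.trans_le hmn)⟩
  have hinter : ⋂ n, C n = A := by
    refine Subset.antisymm (fun y hy => ?_) (subset_iInter fun n => subset_preimage_image _ _)
    choose x hx h using fun n => (hmem n y).1 (mem_iInter.1 hy n)
    suffices ht : Tendsto x atTop (𝓝 y) from
      hA.isClosed.mem_of_tendsto ht (Eventually.of_forall hx)
    refine tendsto_pi_nhds.2 fun i => ?_
    refine tendsto_const_nhds.congr' ?_
    filter_upwards [eventually_gt_atTop i] with n hn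
    exact (h n i hn).symm
  have hm : ∀ n, NullMeasurableSet (C n) mu := fun n =>
    ((hA.image (continuous_coords _)).measurableSet.preimage
    (continuous_coords _).measurable).nullMeasurableSet
  have h := tendsto_measure_iInter_atTop hm hanti ⟨0, measure_ne_top _ _⟩
  rw [hinter] at h
  exact h

/-- Isometries do not decrease the measure of compact sets. -/
lemma measure_le_image {a : ℕ → ℝ} (ha0 : ∀ i, 0 < a i) (ha : Summable fun i => a i ^ 2)
    {K : Set Q} (hK : IsCompact K) (f : Q → Q)
    (hf : ∀ x ∈ K, ∀ y ∈ K, ∑' i, a i ^ 2 * ((f x i : ℝ) - f y i) ^ 2 =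
      ∑' i, a i ^ 2 * ((x i : ℝ) - y i) ^ 2) : mu K ≤ mu (f '' K) := by
  classical
  by_cases h0 : mu K = 0
  · rw [h0]; exact zero_le
  obtain ⟨T, hrow, haff, hdet⟩ := exists_matrix_minors ha0 ha hK h0 f hf
  obtain ⟨y₀, hy₀⟩ := nonempty_of_measure_ne_zero h0
  have hcont : ContinuousOn f K := by
    refine continuousOn_pi.2 fun i => ?_
    have hs : Summable fun j => T i j * a j := summable_mul_of_sq (hrow i) ha
    have h1 : ∀ x ∈ K, (f x i : ℝ) =
        f y₀ i + (X (fun j => T i j * a j) x - X (fun j => T i j * a j) y₀) / a i := by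
      intro x hx
      have h2 := (haff x hx y₀ hy₀ i).tsum_eq
      have h3 : X (fun j => T i j * a j) x - X (fun j => T i j * a j) y₀ =
          a i * ((f x i : ℝ) - f y₀ i) := by
        rw [X, X, ← (summable_mul_V hs x).tsum_sub (summable_mul_V hs y₀), ← h2]
        exact tsum_congr fun j => by rw [V, V]; ring
      rw [h3, mul_div_cancel_left₀ _ (ha0 i).ne']
      ring
    rw [Topology.IsInducing.subtypeVal.continuousOn_iff]
    refine ContinuousOn.congr ?_ h1
    have := continuous_X hs
    fun_prop
  have hfK := hK.image_of_continuousOn hcont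
  have key : ∀ n : ℕ, ∀ δ : ℝ, 0 < δ → δ < 1 → ENNReal.ofReal (1 - δ) * mu K ≤
      mu (coords (fun i : Finset.range n => (i : ℕ)) ⁻¹'
        (coords (fun i : Finset.range n => (i : ℕ)) '' (f '' K))) := by
    intro n δ hδ hδ1
    obtain ⟨I, S, e, hI, hprod, hd⟩ := hdet (Finset.range n) δ hδ hδ1
    have h1 := det_mul_measure_le ha0 hK hfK h0 haff e
    have hdr := det_rescale (Matrix.of fun i k : I => T i (e k)) (fun k => a (e k)) (fun i => a i)
    simp only [Matrix.of_apply] at hdr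
    rw [hdr] at h1
    have hI0 : 0 < ∏ i ∈ I, a i := Finset.prod_pos fun i _ => ha0 i
    have h2 : 1 - δ ≤
        |(Matrix.of fun i k : I => T i (e k)).det * (∏ k, a (e k)) / ∏ i : I, a i| := by
      rw [e.prod_comp fun j : S => a j, Finset.prod_coe_sort S a, Finset.prod_coe_sort I a,
        mul_div_assoc, abs_mul, abs_of_pos (div_pos (hI0.trans_le hprod) hI0)]
      have h3 : 1 ≤ (∏ j ∈ S, a j) / ∏ i ∈ I, a i := (one_le_div hI0).2 hprod
      rw [← sq_abs] at hd
      have h4 := abs_nonneg (Matrix.of fun i k : I => T i (e k)).det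
      have h5 : 1 - δ ≤ |(Matrix.of fun i k : I => T i (e k)).det| := by nlinarith
      nlinarith
    refine le_trans ?_ (h1.trans (measure_mono ?_))
    · gcongr
    · rintro y ⟨x, hx, hxy⟩
      refine ⟨x, hx, ?_⟩
      ext i
      exact congrFun hxy ⟨i, hI i.2⟩
  have h3 : ∀ δ : ℝ, 0 < δ → δ < 1 → ENNReal.ofReal (1 - δ) * mu K ≤ mu (f '' K) :=
    fun δ hδ hδ1 => ge_of_tendsto' (tendsto_mu_cylinder hfK) fun n => key n δ hδ hδ1
  have h4 : Tendsto (fun δ : ℝ => ENNReal.ofReal (1 - δ) * mu K) (𝓝[>] 0) (𝓝 (1 * mu K)) := by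
    refine ENNReal.Tendsto.mul_const ?_ (Or.inl one_ne_zero)
    have : Tendsto (fun δ : ℝ => ENNReal.ofReal (1 - δ)) (𝓝 0) (𝓝 (ENNReal.ofReal (1 - 0))) :=
      (ENNReal.continuous_ofReal.comp (by fun_prop : Continuous fun δ : ℝ => 1 - δ)).tendsto 0
    rw [sub_zero, ENNReal.ofReal_one] at this
    exact this.mono_left nhdsWithin_le_nhds
  rw [one_mul] at h4
  refine le_of_tendsto h4 ?_
  filter_upwards [Ioo_mem_nhdsGT (show (0 : ℝ) < 1 by norm_num)] with δ hδ
  exact h3 δ hδ.1 hδ.2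

/-- The points of the cube as real sequences. -/
def toReal (u : Q) : ℕ → ℝ := fun i => u i

/-- The coordinatewise projection onto the cube. -/
def proj (x : ℕ → ℝ) : Q := fun i => projIcc 0 1 zero_le_one (x i)

lemma measurable_toReal : Measurable toReal := by unfold toReal; fun_prop

lemma measurable_proj : Measurable proj :=
  measurable_pi_lambda _ fun i => continuous_projIcc.measurable.comp (measurable_pi_apply i)

lemma toReal_proj {x : ℕ → ℝ} (hx : x ∈ cube) : toReal (proj x) = x := by
  ext i
  simp [toReal, proj, projIcc_of_mem zero_le_one (hx i)]

lemma proj_apply {x : ℕ → ℝ} (hx : x ∈ cube) (i : ℕ) : (proj x i : ℝ) = x i :=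
  congrFun (toReal_proj hx) i

/-- The boxes `∏ᵢ [0, bᵢ]` with finitely many proper factors. -/
def boxes : Set (Set Q) := {s | ∃ b : Q, {i | b i ≠ 1}.Finite ∧ s = Iic b}

lemma isPiSystem_boxes : IsPiSystem boxes := by
  rintro _ ⟨b, hb, rfl⟩ _ ⟨c, hc, rfl⟩ -
  refine ⟨b ⊓ c, (hb.union hc).subset fun i hi => ?_, Iic_inter_Iic⟩
  by_contra h
  simp only [mem_union, mem_ofPred_eq, not_or, not_not] at h
  exact hi (by rw [Pi.inf_apply, h.1, h.2, inf_idem])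

lemma generateFrom_boxes :
    (inferInstance : MeasurableSpace Q) = MeasurableSpace.generateFrom boxes := by
  classical
  refine le_antisymm (iSup_le fun i => ?_) (MeasurableSpace.generateFrom_le ?_)
  · rw [BorelSpace.measurable_eq (α := unitInterval), borel_eq_generateFrom_Iic,
      MeasurableSpace.comap_generateFrom]
    refine MeasurableSpace.generateFrom_mono ?_
    rintro _ ⟨_, ⟨x, rfl⟩, rfl⟩
    refine ⟨Function.update 1 i x, (finite_singleton i).subset fun j hj => ?_, ?_⟩
    · by_contra h
      exact hj (Function.update_of_ne h _ _)
    · ext u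
      simp only [mem_preimage, mem_Iic, le_update_iff]
      exact ⟨fun h => ⟨h, fun j _ => unitInterval.le_one'⟩, fun h => h.1⟩
  · rintro _ ⟨b, -, rfl⟩
    exact isClosed_Iic.measurableSet

lemma mu_Iic {b : Q} (hb : {i | b i ≠ 1}.Finite) :
    mu (Iic b) = ENNReal.ofReal (∏ i ∈ hb.toFinset, (b i : ℝ)) := by
  have e : Iic b = Set.pi (hb.toFinset : Set ℕ) fun i => Iic (b i) := by
    ext u
    simp only [mem_Iic, Set.mem_pi, Finite.coe_toFinset, mem_ofPred_eq]
    refine ⟨fun h i _ => h i, fun h i => ?_⟩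
    by_cases hi : b i = 1
    · rw [hi]; exact unitInterval.le_one'
    · exact h i hi
  rw [e, mu, Measure.infinitePi_pi _ fun i _ => measurableSet_Iic,
    ENNReal.ofReal_prod_of_nonneg fun i _ => (b i).2.1]
  exact Finset.prod_congr rfl fun i _ => unitInterval.volume_Iic _

/-- The product measure is determined by the volumes of the basic cylinders. -/
lemma measure_eq_mu {π : Measure (ℕ → ℝ)} (hπ : ∀ lo hi : ℕ → ℝ, IsBCData lo hi →
      π (cylSet lo hi) = ENNReal.ofReal (bcVol lo hi)) {E : Set (ℕ → ℝ)} (hE : MeasurableSet E)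
    (hcube : E ⊆ cube) : π E = mu (toReal ⁻¹' E) := by
  have hbox : ∀ b : Q, {i | b i ≠ 1}.Finite → (π.restrict cube).map proj (Iic b) = mu (Iic b) := by
    intro b hb
    have hpre : proj ⁻¹' Iic b ∩ cube = cylSet 0 (toReal b) := by
      ext x
      constructor
      · rintro ⟨hx, hxc⟩ i
        exact ⟨(hxc i).1, (proj_apply hxc i).symm.trans_le (hx i)⟩
      · intro h
        have hxc : x ∈ cube := fun i => ⟨(h i).1, (h i).2.trans (b i).2.2⟩
        exact ⟨fun i => Subtype.coe_le_coe.1 ((proj_apply hxc i).trans_le (h i).2), hxc⟩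
    have hbc : IsBCData 0 (toReal b) := by
      refine ⟨fun _ => le_rfl, fun i => (b i).2.1, fun i => (b i).2.2,
        hb.subset fun i hi h => hi ?_⟩
      exact ⟨rfl, by rw [toReal, h]; rfl⟩
    rw [Measure.map_apply measurable_proj isClosed_Iic.measurableSet,
      Measure.restrict_apply (measurable_proj isClosed_Iic.measurableSet), hpre, hπ _ _ hbc,
      mu_Iic hb, bcVol,
      finprod_eq_prod_of_mulSupport_subset (s := hb.toFinset)]
    · simp [toReal]
    · intro i hi
      rw [Finite.coe_toFinset]
      exact fun h => hi (by simp [toReal, h])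
  have huniv : Iic (1 : Q) = univ := eq_univ_of_forall fun u i => unitInterval.le_one'
  have h1 := hbox 1 (by simp)
  rw [huniv] at h1
  have hν : (π.restrict cube).map proj = mu := by
    have : IsFiniteMeasure ((π.restrict cube).map proj) := ⟨h1.trans_lt (measure_lt_top _ _)⟩
    refine ext_of_generate_finite boxes generateFrom_boxes isPiSystem_boxes ?_ h1
    rintro _ ⟨b, hb, rfl⟩
    exact hbox b hb
  have hm := measurable_toReal hE
  rw [← hν, Measure.map_apply measurable_proj hm, Measure.restrict_apply (measurable_proj hm)]
  congr 1
  ext x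
  simp only [mem_inter_iff, mem_preimage]
  refine ⟨fun h => ⟨by rwa [toReal_proj (hcube h)], hcube h⟩, fun h => ?_⟩
  rw [← toReal_proj h.2]
  exact h.1

lemma tsum_eq_of_da_eq {a x y x' y' : ℕ → ℝ} (h : da a x y = da a x' y') :
    ∑' i, a i ^ 2 * (x i - y i) ^ 2 = ∑' i, a i ^ 2 * (x' i - y' i) ^ 2 :=
  (Real.sqrt_inj (tsum_nonneg fun i => by positivity) (tsum_nonneg fun i => by positivity)).1 h

/-- Isometries into a measurable set do not decrease measure. -/
lemma measure_le_of_mapsTo {a : ℕ → ℝ} (ha : ∀ i, 0 < a i) (hsum : Summable fun i => a i ^ 2)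
    {π : Measure (ℕ → ℝ)} (hπ : ∀ lo hi : ℕ → ℝ, IsBCData lo hi →
      π (cylSet lo hi) = ENNReal.ofReal (bcVol lo hi)) {E F : Set (ℕ → ℝ)} (hE : E ⊆ cube)
    (hF : F ⊆ cube) (hmE : MeasurableSet E) (hmF : MeasurableSet F) {f : (ℕ → ℝ) → ℕ → ℝ}
    (hf : IsIsomOn a f E) (hmaps : MapsTo f E F) : π E ≤ π F := by
  rw [measure_eq_mu hπ hmE hE, measure_eq_mu hπ hmF hF]
  refine le_of_forall_lt fun r hr => ?_
  obtain ⟨K, hKE, hK, hrK⟩ := (measurable_toReal hmE).exists_lt_isCompact hr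
  have hcoe : ∀ x ∈ K, toReal (proj (f (toReal x))) = f (toReal x) := fun x hx =>
    toReal_proj (hF (hmaps (hKE hx)))
  refine hrK.trans_le ((measure_le_image ha hsum hK (fun x => proj (f (toReal x)))
    fun x hx y hy => ?_).trans (measure_mono ?_))
  · have h := hf _ (hKE hx) _ (hKE hy)
    rw [← hcoe x hx, ← hcoe y hy] at h
    exact tsum_eq_of_da_eq h
  · rintro _ ⟨x, hx, rfl⟩
    rw [mem_preimage, hcoe x hx]
    exact hmaps (hKE hx)

end HilbertCube

/-- Ulam's conjecture on invariance of measure: the standard product probability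
measure `π` on the Hilbert cube (characterized by
`π(∏ᵢ[loᵢ,hiᵢ]) = ∏ᵢ(hiᵢ - loᵢ)` on basic cylinders) is `d_a`-invariant: Borel
subsets of `I^ω` that are `d_a`-isometric have equal measure. -/
theorem ulam_stmt19 (a : ℕ → ℝ) (ha : ∀ i, 0 < a i)
    (hsum : Summable fun i => (a i) ^ 2)
    (π : MeasureTheory.Measure (ℕ → ℝ))
    (hπ : ∀ lo hi : ℕ → ℝ, IsBCData lo hi →
      π (cylSet lo hi) = ENNReal.ofReal (bcVol lo hi))
    (E₁ E₂ : Set (ℕ → ℝ)) (h₁ : E₁ ⊆ cube) (h₂ : E₂ ⊆ cube)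
    (hm₁ : MeasurableSet E₁) (hm₂ : MeasurableSet E₂)
    (f : (ℕ → ℝ) → ℕ → ℝ) (hf : IsIsomOn a f E₁) (hfs : f '' E₁ = E₂) :
    π E₁ = π E₂ := by
  classical
  have hinv : ∀ y : ℕ → ℝ, ∃ x, y ∈ E₂ → x ∈ E₁ ∧ f x = y := fun y => by
    by_cases hy : y ∈ E₂
    · rw [← hfs] at hy
      obtain ⟨x, hx, hxy⟩ := hy
      exact ⟨x, fun _ => ⟨hx, hxy⟩⟩
    · exact ⟨y, fun h => (hy h).elim⟩
  choose g hg using hinv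
  refine le_antisymm
    (HilbertCube.measure_le_of_mapsTo ha hsum hπ h₁ h₂ hm₁ hm₂ hf (hfs ▸ Set.mapsTo_image f E₁))
    (HilbertCube.measure_le_of_mapsTo (f := g) ha hsum hπ h₂ h₁ hm₂ hm₁ (fun x hx y hy => ?_)
      fun y hy => (hg y hy).1)
  rw [← hf _ (hg x hx).1 _ (hg y hy).1, (hg x hx).2, (hg y hy).2]
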